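/- arXiv:2603.24499 — 7 statements merged into one kernel-verified Lean document; each statement's English description precedes it below -/
import Mathlib

section
/- For every integer n ≥ 1, the number of subgroups of index exactly n in the group ℤ × ℤ equals σ(n), the sum of the (positive) divisors of n. -/
theorem AddSubgroup.index_eq_index_map_fst_mul_index_comap_inr {A B : Type*} [AddCommGroup A]
    [AddCommGroup B] (H : AddSubgroup (A × B)) :
    H.index = (H.map (AddMonoidHom.fst A B)).index * (H.comap (AddMonoidHom.inr A B)).index := by
  have hfst : (AddMonoidHom.fst A B).range = ⊤ :=
    AddMonoidHom.range_eq_top.2 Prod.fst_surjective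
  have hker : (AddMonoidHom.inr A B).range = (AddMonoidHom.fst A B).ker := by
    ext ⟨x, y⟩
    simp [AddSubgroup.mem_prod, AddMonoidHom.mem_range, eq_comm]
  rw [AddSubgroup.index_map, AddSubgroup.index_comap, hfst, hker, AddSubgroup.index_top, mul_one,
    ← AddSubgroup.relIndex_sup_left, mul_comm,
    AddSubgroup.relIndex_mul_index le_sup_left]

/-- The subgroup of `ℤ × ℤ` generated by `(a, b)` and `(0, d)`. -/
def hermiteSubgroup (a b d : ℤ) : AddSubgroup (ℤ × ℤ) where
  carrier := {p | ∃ k l : ℤ, p = (a * k, b * k + d * l)}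
  zero_mem' := ⟨0, 0, by ext <;> simp⟩
  add_mem' := by
    rintro _ _ ⟨k, l, rfl⟩ ⟨k', l', rfl⟩
    exact ⟨k + k', l + l', by ext <;> simp <;> ring⟩
  neg_mem' := by
    rintro _ ⟨k, l, rfl⟩
    exact ⟨-k, -l, by ext <;> simp; ring⟩

theorem mem_hermiteSubgroup {a b d : ℤ} {p : ℤ × ℤ} :
    p ∈ hermiteSubgroup a b d ↔ ∃ k l : ℤ, p = (a * k, b * k + d * l) :=
  Iff.rfl

theorem map_fst_hermiteSubgroup (a b d : ℤ) :
    (hermiteSubgroup a b d).map (AddMonoidHom.fst ℤ ℤ) = AddSubgroup.zmultiples a := by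
  ext x
  simp only [AddSubgroup.mem_map, mem_hermiteSubgroup, Int.mem_zmultiples_iff]
  constructor
  · rintro ⟨_, ⟨k, l, rfl⟩, rfl⟩
    exact ⟨k, rfl⟩
  · rintro ⟨k, rfl⟩
    exact ⟨_, ⟨k, 0, rfl⟩, rfl⟩

theorem comap_inr_hermiteSubgroup {a : ℤ} (ha : a ≠ 0) (b d : ℤ) :
    (hermiteSubgroup a b d).comap (AddMonoidHom.inr ℤ ℤ) = AddSubgroup.zmultiples d := by
  ext y
  simp only [AddSubgroup.mem_comap, mem_hermiteSubgroup, Int.mem_zmultiples_iff,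
    AddMonoidHom.inr_apply, Prod.mk.injEq]
  constructor
  · rintro ⟨k, l, hk, rfl⟩
    obtain rfl : k = 0 := by simpa [ha] using hk.symm
    exact ⟨l, by ring⟩
  · rintro ⟨l, rfl⟩
    exact ⟨0, l, by simp⟩

theorem index_hermiteSubgroup {a : ℤ} (ha : a ≠ 0) (b d : ℤ) :
    (hermiteSubgroup a b d).index = a.natAbs * d.natAbs := by
  rw [AddSubgroup.index_eq_index_map_fst_mul_index_comap_inr, map_fst_hermiteSubgroup,
    comap_inr_hermiteSubgroup ha, Int.index_zmultiples, Int.index_zmultiples]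

theorem eq_zmultiples_index (H : AddSubgroup ℤ) : H = AddSubgroup.zmultiples (H.index : ℤ) := by
  obtain ⟨a, rfl⟩ := Int.subgroup_cyclic H
  rw [← AddSubgroup.zmultiples_eq_closure, Int.index_zmultiples, Int.zmultiples_natAbs]

theorem exists_eq_hermiteSubgroup (H : AddSubgroup (ℤ × ℤ)) (hH : H.index ≠ 0) :
    ∃ a d b : ℕ, a * d = H.index ∧ b < d ∧ H = hermiteSubgroup a b d := by
  have hmul := H.index_eq_index_map_fst_mul_index_comap_inr
  have hfst := eq_zmultiples_index (H.map (AddMonoidHom.fst ℤ ℤ))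
  have hinr := eq_zmultiples_index (H.comap (AddMonoidHom.inr ℤ ℤ))
  generalize (H.map (AddMonoidHom.fst ℤ ℤ)).index = a at *
  generalize (H.comap (AddMonoidHom.inr ℤ ℤ)).index = d at *
  have hd : (d : ℤ) ≠ 0 := by
    rintro h
    simp_all
  have mem_inr (y : ℤ) : (0, y) ∈ H ↔ (d : ℤ) ∣ y := by
    rw [← Int.mem_zmultiples_iff, ← hinr]
    rfl
  obtain ⟨⟨x, y⟩, hxy, hx⟩ : (a : ℤ) ∈ H.map (AddMonoidHom.fst ℤ ℤ) := by
    rw [hfst]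
    exact AddSubgroup.mem_zmultiples _
  obtain rfl : x = a := hx
  have hb := Int.emod_nonneg y hd
  have hlt := Int.emod_lt_of_pos y (show (0 : ℤ) < d by omega)
  have hab : ((a : ℤ), y % d) ∈ H := by
    have := H.sub_mem hxy ((mem_inr (d * (y / d))).2 (dvd_mul_right _ _))
    convert this using 1
    ext
    · simp
    · simp [Int.emod_def]
  lift y % (d : ℤ) to ℕ using hb with b
  refine ⟨a, d, b, hmul.symm, by exact_mod_cast hlt, ?_⟩
  have key (k z : ℤ) : ((a : ℤ) * k, z) ∈ H ↔ (d : ℤ) ∣ z - b * k := by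
    rw [← mem_inr, ← H.add_mem_cancel_right (x := k • ((a : ℤ), (b : ℤ))) (y := (0, _))
      (H.zsmul_mem hab k)]
    simp [mul_comm]
  ext ⟨u, v⟩
  rw [mem_hermiteSubgroup]
  constructor
  · intro h
    have hu : u ∈ H.map (AddMonoidHom.fst ℤ ℤ) := ⟨_, h, rfl⟩
    rw [hfst, Int.mem_zmultiples_iff] at hu
    obtain ⟨k, rfl⟩ := hu
    obtain ⟨l, hl⟩ := (key k v).1 h
    exact ⟨k, l, by rw [← hl]; simp⟩
  · rintro ⟨k, l, h⟩
    rw [h, key]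
    exact ⟨l, by ring⟩

theorem card_addSubgroup_int_prod_int_index_eq {n : ℕ} (hn : n ≠ 0) :
    Nat.card {H : AddSubgroup (ℤ × ℤ) // H.index = n} = ∑ d ∈ n.divisors, d := by
  have ne_zero {d : ℕ} (hd : d ∈ n.divisors) : ((n / d : ℕ) : ℤ) ≠ 0 := by
    have := Nat.div_pos (Nat.divisor_le hd) (Nat.pos_of_mem_divisors hd)
    omega
  let f : (Σ d : n.divisors, Fin d) → {H : AddSubgroup (ℤ × ℤ) // H.index = n} := fun p =>
    ⟨hermiteSubgroup (n / p.1 : ℕ) (p.2 : ℕ) (p.1 : ℕ), by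
      rw [index_hermiteSubgroup (ne_zero p.1.2), Int.natAbs_natCast, Int.natAbs_natCast,
        Nat.div_mul_cancel (Nat.dvd_of_mem_divisors p.1.2)]⟩
  have hf : Function.Bijective f := by
    constructor
    · rintro ⟨⟨d, hd⟩, b, hb⟩ ⟨⟨d', hd'⟩, b', hb'⟩ h
      replace h := congrArg Subtype.val h
      dsimp only [f] at h hb hb'
      have hdd := congrArg (fun H => (H.comap (AddMonoidHom.inr ℤ ℤ)).index) h
      simp only [comap_inr_hermiteSubgroup (ne_zero hd), comap_inr_hermiteSubgroup (ne_zero hd'),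
        Int.index_zmultiples, Int.natAbs_natCast] at hdd
      subst hdd
      have hmem : (((n / d : ℕ) : ℤ), (b : ℤ)) ∈ hermiteSubgroup (n / d : ℕ) b' d := by
        rw [← h]
        exact ⟨1, 0, by simp⟩
      obtain ⟨k, l, hkl⟩ := hmem
      rw [Prod.mk.injEq] at hkl
      obtain rfl : k = 1 := (mul_eq_left₀ (ne_zero hd)).1 hkl.1.symm
      have hmod : b ≡ b' [MOD d] := by
        rw [← Int.natCast_modEq_iff, hkl.2]
        simp [Int.ModEq]
      obtain rfl := hmod.eq_of_lt_of_lt hb hb'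
      rfl
    · rintro ⟨H, rfl⟩
      obtain ⟨a, d, b, had, hb, hH⟩ := exists_eq_hermiteSubgroup H hn
      refine ⟨⟨⟨d, Nat.mem_divisors.2 ⟨⟨a, by rw [← had, mul_comm]⟩, hn⟩⟩, b, hb⟩,
        Subtype.ext ?_⟩
      dsimp only [f]
      rw [← had, Nat.mul_div_cancel _ (by omega), ← hH]
  rw [← Nat.card_congr (Equiv.ofBijective f hf), Nat.card_eq_fintype_card, Fintype.card_sigma]
  simp only [Fintype.card_fin]
  exact Finset.sum_coe_sort n.divisors fun d => d

theorem subgroup_count_Z2_eq_sigma (n : ℕ) (hn : 1 ≤ n) :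
    Nat.card {H : Subgroup (Multiplicative (ℤ × ℤ)) // H.index = n} =
      ArithmeticFunction.sigma 1 n := by
  rw [ArithmeticFunction.sigma_one_apply,
    ← card_addSubgroup_int_prod_int_index_eq (Nat.one_le_iff_ne_zero.1 hn)]
  exact Nat.card_congr (Subgroup.toAddSubgroup'.toEquiv.subtypeEquiv fun H => Iff.rfl)
end

section
/- (Hermite–Eisenstein.) For every integer ℓ ≥ 1 and every integer n ≥ 1, the number of subgroups of index exactly n in the free abelian group ℤ^ℓ equals ∑ over all ℓ-tuples (δ₁, …, δ_ℓ) of positive integers with δ₁·δ₂·⋯·δ_ℓ = n of the product δ₁^{ℓ−1}·δ₂^{ℓ−2}·⋯·δ_{ℓ−1}^{1}·δ_ℓ^{0}. -/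
open scoped BigOperators

namespace AddSubgroup

variable {M : Type*} [AddCommGroup M]

/-- The index of a subgroup of `ℤ × M` is the product of the indices of its projection to `ℤ` and
of its fibre over `0`. -/
theorem index_eq_index_map_fst_mul_index_comap_inr_s12 (H : AddSubgroup (ℤ × M)) :
    H.index = (H.map (AddMonoidHom.fst ℤ M)).index * (H.comap (AddMonoidHom.inr ℤ M)).index := by
  have hk : (AddMonoidHom.inr ℤ M).range = (AddMonoidHom.fst ℤ M).ker := by
    ext ⟨a, w⟩
    simp only [AddMonoidHom.mem_ker, AddMonoidHom.mem_range, AddMonoidHom.inr_apply,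
      AddMonoidHom.coe_fst, Prod.mk.injEq, exists_eq_right]
    simp [eq_comm]
  have hr : (AddMonoidHom.fst ℤ M).range = ⊤ :=
    AddMonoidHom.range_eq_top.2 fun a => ⟨(a, 0), rfl⟩
  rw [index_map, index_comap, hk, hr, index_top, mul_one, ← relIndex_sup_left, mul_comm,
    relIndex_mul_index le_sup_left]

/-- The subgroup of `ℤ × M` with projection `dℤ` to `ℤ`, fibre `K` over `0` and fibre `x` over
`d`. -/
def ofProjFiber (d : ℕ) (K : AddSubgroup M) (x : M ⧸ K) : AddSubgroup (ℤ × M) :=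
  (zmultiples ((d : ℤ), x)).comap ((AddMonoidHom.id ℤ).prodMap (QuotientAddGroup.mk' K))

theorem mem_ofProjFiber {d : ℕ} {K : AddSubgroup M} {x : M ⧸ K} {a : ℤ} {w : M} :
    (a, w) ∈ ofProjFiber d K x ↔ ∃ k : ℤ, k * d = a ∧ k • x = w := by
  simp [ofProjFiber, mem_zmultiples_iff]

theorem map_fst_ofProjFiber (d : ℕ) (K : AddSubgroup M) (x : M ⧸ K) :
    (ofProjFiber d K x).map (AddMonoidHom.fst ℤ M) = zmultiples (d : ℤ) := by
  ext a
  simp only [mem_map, Prod.exists, mem_ofProjFiber, mem_zmultiples_iff, smul_eq_mul]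
  constructor
  · rintro ⟨_, w, ⟨k, rfl, -⟩, rfl⟩
    exact ⟨k, rfl⟩
  · rintro ⟨k, rfl⟩
    obtain ⟨w, hw⟩ := QuotientAddGroup.mk_surjective (k • x)
    exact ⟨_, w, ⟨k, rfl, hw.symm⟩, rfl⟩

theorem comap_inr_ofProjFiber {d : ℕ} (hd : d ≠ 0) (K : AddSubgroup M) (x : M ⧸ K) :
    (ofProjFiber d K x).comap (AddMonoidHom.inr ℤ M) = K := by
  ext w
  simp [mem_ofProjFiber, hd, eq_comm (a := (0 : M ⧸ K))]

theorem index_ofProjFiber {d : ℕ} (hd : d ≠ 0) (K : AddSubgroup M) (x : M ⧸ K) :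
    (ofProjFiber d K x).index = d * K.index := by
  rw [index_eq_index_map_fst_mul_index_comap_inr_s12, map_fst_ofProjFiber, comap_inr_ofProjFiber hd,
    Int.index_zmultiples, Int.natAbs_natCast]

theorem ofProjFiber_injective {d : ℕ} (hd : d ≠ 0) (K : AddSubgroup M) :
    Function.Injective (ofProjFiber d K) := by
  intro x y h
  obtain ⟨v, rfl⟩ := QuotientAddGroup.mk_surjective x
  have hv : ((d : ℤ), v) ∈ ofProjFiber d K v := mem_ofProjFiber.2 ⟨1, by simp⟩
  rw [h, mem_ofProjFiber] at hv
  obtain ⟨k, hk, hkv⟩ := hv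
  obtain rfl : k = 1 := by simpa [hd] using hk
  simpa using hkv.symm

theorem exists_ofProjFiber_eq {H : AddSubgroup (ℤ × M)} (hH : H.index ≠ 0) :
    ∃ (d : ℕ) (K : AddSubgroup M) (x : M ⧸ K), d ≠ 0 ∧ ofProjFiber d K x = H := by
  obtain ⟨g, hg⟩ := Int.subgroup_cyclic (H.map (AddMonoidHom.fst ℤ M))
  rw [← zmultiples_eq_closure, ← Int.zmultiples_natAbs] at hg
  set d := g.natAbs
  have hd : d ≠ 0 := by
    intro hd
    apply hH
    rw [index_eq_index_map_fst_mul_index_comap_inr_s12, hg, Int.index_zmultiples]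
    simp [hd]
  obtain ⟨⟨_, v⟩, hv, rfl : _ = (d : ℤ)⟩ : (d : ℤ) ∈ H.map (AddMonoidHom.fst ℤ M) :=
    hg ▸ mem_zmultiples _
  refine ⟨d, H.comap (AddMonoidHom.inr ℤ M), v, hd, ?_⟩
  have key (k : ℤ) (w : M) :
      k • (v : M ⧸ H.comap (AddMonoidHom.inr ℤ M)) = w ↔ (k * (d : ℤ), w) ∈ H := by
    rw [← QuotientAddGroup.mk_zsmul, QuotientAddGroup.eq, mem_comap,
      ← H.add_mem_cancel_left (H.zsmul_mem hv k)]
    simp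
  ext ⟨a, w⟩
  rw [mem_ofProjFiber]
  constructor
  · rintro ⟨k, rfl, hk⟩
    exact (key k w).1 hk
  · intro h
    obtain ⟨k, rfl⟩ : ∃ k : ℤ, k * d = a := by
      have ha : a ∈ H.map (AddMonoidHom.fst ℤ M) := ⟨_, h, rfl⟩
      rwa [hg, mem_zmultiples_iff] at ha
    exact ⟨k, rfl, (key k w).2 h⟩

/-- The subgroup of index `n` of `ℤ × M` attached to a factorization `n = d * m`, a subgroup `K` of
`M` of index `m` and a coset of `K`. -/
def ofSigma (M : Type*) [AddCommGroup M] {n : ℕ} (hn : n ≠ 0)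
    (p : Σ q : n.divisorsAntidiagonal, Σ K : {K : AddSubgroup M // K.index = q.1.2}, M ⧸ K.1) :
    {H : AddSubgroup (ℤ × M) // H.index = n} :=
  ⟨ofProjFiber p.1.1.1 p.2.1.1 p.2.2, by
    have hq := (Nat.mem_divisorsAntidiagonal.1 p.1.2).1
    rw [index_ofProjFiber (left_ne_zero_of_mul (hq.trans_ne hn)), p.2.1.2, hq]⟩

theorem ofSigma_bijective {n : ℕ} (hn : n ≠ 0) : Function.Bijective (ofSigma M hn) := by
  constructor
  · rintro ⟨⟨⟨d, m⟩, hq⟩, ⟨K, hK⟩, x⟩ ⟨⟨⟨d', m'⟩, hq'⟩, ⟨K', hK'⟩, x'⟩ h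
    have hd : d ≠ 0 := left_ne_zero_of_mul ((Nat.mem_divisorsAntidiagonal.1 hq).1.trans_ne hn)
    have hd' : d' ≠ 0 := left_ne_zero_of_mul ((Nat.mem_divisorsAntidiagonal.1 hq').1.trans_ne hn)
    simp only [ofSigma, Subtype.mk.injEq] at h hK hK'
    have hKK := congrArg (comap (AddMonoidHom.inr ℤ M)) h
    rw [comap_inr_ofProjFiber hd, comap_inr_ofProjFiber hd'] at hKK
    have hdd := congrArg (fun H => (map (AddMonoidHom.fst ℤ M) H).index) h
    simp only [map_fst_ofProjFiber, Int.index_zmultiples, Int.natAbs_natCast] at hdd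
    subst hKK hdd hK hK'
    rw [ofProjFiber_injective hd K h]
  · rintro ⟨H, rfl⟩
    obtain ⟨d, K, x, hd, rfl⟩ := exists_ofProjFiber_eq hn
    exact ⟨⟨⟨(d, K.index), by simp [← index_ofProjFiber hd K x, hn]⟩, ⟨K, rfl⟩, x⟩, rfl⟩

theorem finite_and_card_index_eq_int_prod
    (h : ∀ m ≠ 0, Finite {K : AddSubgroup M // K.index = m}) {n : ℕ} (hn : n ≠ 0) :
    Finite {H : AddSubgroup (ℤ × M) // H.index = n} ∧
      Nat.card {H : AddSubgroup (ℤ × M) // H.index = n} =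
        ∑ q ∈ n.divisorsAntidiagonal, q.2 * Nat.card {K : AddSubgroup M // K.index = q.2} := by
  have hm (q : n.divisorsAntidiagonal) : q.1.2 ≠ 0 :=
    right_ne_zero_of_mul ((Nat.mem_divisorsAntidiagonal.1 q.2).1.trans_ne hn)
  have hK (q : n.divisorsAntidiagonal) := h _ (hm q)
  have hQ (q : n.divisorsAntidiagonal) (K : {K : AddSubgroup M // K.index = q.1.2}) :
      Finite (M ⧸ K.1) :=
    have : K.1.FiniteIndex := ⟨K.2.trans_ne (hm q)⟩
    finite_quotient_of_finiteIndex
  let e := Equiv.ofBijective _ (ofSigma_bijective (M := M) hn)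
  refine ⟨.of_equiv _ e, ?_⟩
  rw [← Nat.card_congr e, Nat.card_sigma, ← Finset.sum_coe_sort n.divisorsAntidiagonal]
  refine Finset.sum_congr rfl fun q _ => ?_
  have := Fintype.ofFinite {K : AddSubgroup M // K.index = q.1.2}
  rw [Nat.card_sigma, Finset.sum_congr rfl fun K _ => K.2]
  simp [mul_comm]

/-- Isomorphic groups have equivalent types of subgroups of index `n`. -/
def indexEqEquiv {G G' : Type*} [AddGroup G] [AddGroup G'] (e : G ≃+ G') (n : ℕ) :
    {H : AddSubgroup G // H.index = n} ≃ {H : AddSubgroup G' // H.index = n} :=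
  e.mapAddSubgroup.toEquiv.subtypeEquiv fun H => by
    rw [← index_map_equiv H e]
    rfl

end AddSubgroup

theorem Nat.sum_finMulAntidiag_succ {A : Type*} [AddCommMonoid A] (ℓ n : ℕ)
    (f : (Fin (ℓ + 1) → ℕ) → A) :
    ∑ δ ∈ finMulAntidiag (ℓ + 1) n, f δ =
      ∑ q ∈ n.divisorsAntidiagonal, ∑ δ ∈ finMulAntidiag ℓ q.2, f (Fin.cons q.1 δ) := by
  rw [Finset.sum_sigma']
  refine Finset.sum_bij' (fun δ _ => ⟨(δ 0, ∏ i, Fin.tail δ i), Fin.tail δ⟩)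
    (fun p _ => Fin.cons p.1.1 p.2) ?_ ?_ ?_ ?_ ?_
  · intro δ hδ
    obtain ⟨h, hn⟩ := mem_finMulAntidiag.1 hδ
    rw [Fin.prod_univ_succ] at h
    simp only [Finset.mem_sigma, mem_divisorsAntidiagonal, mem_finMulAntidiag, true_and]
    exact ⟨⟨h, hn⟩, right_ne_zero_of_mul (h.trans_ne hn)⟩
  · rintro ⟨⟨d, m⟩, δ⟩ hp
    simp only [Finset.mem_sigma, mem_divisorsAntidiagonal, mem_finMulAntidiag] at hp
    simp [mem_finMulAntidiag, Fin.prod_univ_succ, hp]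
  · simp
  · rintro ⟨⟨d, m⟩, δ⟩ hp
    simp only [Finset.mem_sigma, mem_divisorsAntidiagonal, mem_finMulAntidiag] at hp
    simp [← hp.2.1]
  · simp

theorem finite_and_card_addSubgroup_index_eq (ℓ : ℕ) {n : ℕ} (hn : n ≠ 0) :
    Finite {H : AddSubgroup (Fin ℓ → ℤ) // H.index = n} ∧
      Nat.card {H : AddSubgroup (Fin ℓ → ℤ) // H.index = n} =
        ∑ δ ∈ Nat.finMulAntidiag ℓ n, ∏ i : Fin ℓ, δ i ^ (i : ℕ) := by
  induction ℓ generalizing n with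
  | zero =>
    have h1 (H : AddSubgroup (Fin 0 → ℤ)) : H.index = 1 := by
      rw [Subsingleton.elim H ⊤, AddSubgroup.index_top]
    refine ⟨inferInstance, ?_⟩
    obtain rfl | hn1 := eq_or_ne n 1
    · have : Unique {H : AddSubgroup (Fin 0 → ℤ) // H.index = 1} :=
        ⟨⟨⟨⊤, h1 ⊤⟩⟩, fun _ => Subsingleton.elim _ _⟩
      simp [Nat.finMulAntidiag_one]
    · have : IsEmpty {H : AddSubgroup (Fin 0 → ℤ) // H.index = n} :=
        ⟨fun H => hn1 (H.2.symm.trans (h1 H.1))⟩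
      simp [Nat.finMulAntidiag_zero_left hn1]
  | succ ℓ ih =>
    let e := AddSubgroup.indexEqEquiv (Fin.consLinearEquiv ℤ fun _ : Fin (ℓ + 1) => ℤ).toAddEquiv n
    obtain ⟨hfin, hcard⟩ := AddSubgroup.finite_and_card_index_eq_int_prod
      (fun m hm => (ih (n := m) hm).1) hn
    refine ⟨.of_equiv _ e, ?_⟩
    rw [← Nat.card_congr e, hcard, Nat.sum_finMulAntidiag_succ]
    refine Finset.sum_congr rfl fun q hq => ?_
    have hq0 : q.2 ≠ 0 :=
      right_ne_zero_of_mul ((Nat.mem_divisorsAntidiagonal.1 hq).1.trans_ne hn)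
    rw [(ih hq0).2, Finset.mul_sum]
    refine Finset.sum_congr rfl fun δ hδ => ?_
    rw [← (Nat.mem_finMulAntidiag.1 hδ).1, ← Finset.prod_mul_distrib]
    simp [Fin.prod_univ_succ, pow_succ']

/-- Hermite–Eisenstein formula for the number of finite-index subgroups of `ℤ^ℓ`. -/
theorem hermite_eisenstein (ℓ : ℕ) (hℓ : 1 ≤ ℓ) (n : ℕ) (hn : 1 ≤ n) :
    Nat.card {H : AddSubgroup (Fin ℓ → ℤ) // H.index = n} =
      ∑ᶠ (δ : Fin ℓ → ℕ) (_ : (∀ i, 0 < δ i) ∧ ∏ i, δ i = n),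
        ∏ i : Fin ℓ, δ i ^ (ℓ - 1 - (i : ℕ)) := by
  have hn0 : n ≠ 0 := Nat.one_le_iff_ne_zero.1 hn
  rw [(finite_and_card_addSubgroup_index_eq ℓ hn0).2,
    finsum_cond_eq_sum_of_cond_iff (fun δ : Fin ℓ → ℕ => ∏ i : Fin ℓ, δ i ^ (ℓ - 1 - (i : ℕ)))
      (p := fun δ => (∀ i, 0 < δ i) ∧ ∏ i, δ i = n) (t := Nat.finMulAntidiag ℓ n)]
  · refine Finset.sum_equiv (Fin.revPerm.arrowCongr (Equiv.refl ℕ)) (fun δ => ?_) fun δ _ => ?_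
    · simp only [Nat.mem_finMulAntidiag]
      rw [← Equiv.prod_comp Fin.revPerm δ]
      rfl
    · rw [← Equiv.prod_comp Fin.revPerm]
      refine Finset.prod_congr rfl fun i _ => ?_
      simp only [Equiv.arrowCongr_apply, Function.comp_apply, Equiv.refl_apply, Fin.revPerm_symm,
        Fin.revPerm_apply, Fin.val_rev]
      congr 1
      omega
  · intro δ _
    refine ⟨fun h => Nat.mem_finMulAntidiag.2 ⟨h.2, hn0⟩, fun h => ⟨fun i => ?_, ?_⟩⟩
    · exact Nat.pos_of_ne_zero (Nat.ne_zero_of_mem_finMulAntidiag h i)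
    · exact Nat.prod_eq_of_mem_finMulAntidiag h
end

section
/- For every integer ℓ ≥ 1 and every complex number s with Re(s) > ℓ, the Dirichlet series ∑_{n=1}^{∞} a_n(ℤ^ℓ)·n^{−s} converges absolutely and equals the product ζ(s)·ζ(s−1)·⋯·ζ(s−ℓ+1) = ∏_{j=0}^{ℓ−1} ζ(s−j), where ζ is the Riemann zeta function. -/
open scoped BigOperators

namespace AddSubgroup

/-- The number of subgroups of index `n` in `G`. -/
noncomputable def indexCount (G : Type*) [AddGroup G] (n : ℕ) : ℕ :=
  Nat.card {H : AddSubgroup G // H.index = n}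

/-- An isomorphism of groups induces a bijection between the subgroups of given index. -/
def indexEquiv {G G' : Type*} [AddGroup G] [AddGroup G'] (e : G ≃+ G') (n : ℕ) :
    {H : AddSubgroup G // H.index = n} ≃ {H : AddSubgroup G' // H.index = n} :=
  e.mapAddSubgroup.toEquiv.subtypeEquiv fun H ↦ by
    change _ ↔ (H.map (e : G →+ G')).index = n
    rw [index_map_equiv]

lemma eq_zmultiples_index (H : AddSubgroup ℤ) : H = zmultiples (H.index : ℤ) := by
  obtain ⟨g, rfl⟩ := Int.subgroup_cyclic H
  rw [← zmultiples_eq_closure, Int.index_zmultiples, Int.zmultiples_natAbs]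

section Extension

variable {A : Type*} [AddCommGroup A]

lemma index_eq_mul_of_int_prod (H : AddSubgroup (ℤ × A)) :
    H.index = (H.comap (AddMonoidHom.inr ℤ A)).index * (H.map (AddMonoidHom.fst ℤ A)).index := by
  have hker : (AddMonoidHom.inr ℤ A).range = (AddMonoidHom.fst ℤ A).ker := by
    ext ⟨z, a⟩
    simp [AddMonoidHom.mem_range, mem_prod, eq_comm]
  rw [index_comap, hker, index_map,
    AddMonoidHom.range_eq_top_of_surjective _ Prod.fst_surjective, index_top, mul_one,
    ← relIndex_sup_left (K := H), relIndex_mul_index le_sup_left]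

/-- The subgroup of `ℤ × A` with intersection `K` with `A` and projection `m ℤ` to `ℤ`, in which
the elements above `m` form the coset `c` of `K`. -/
def intExtension (K : AddSubgroup A) (m : ℕ) (c : A ⧸ K) : AddSubgroup (ℤ × A) :=
  (zmultiples ((m : ℤ), c)).comap ((AddMonoidHom.id ℤ).prodMap (QuotientAddGroup.mk' K))

lemma mem_intExtension {K : AddSubgroup A} {m : ℕ} {c : A ⧸ K} {x : ℤ × A} :
    x ∈ intExtension K m c ↔ ∃ k : ℤ, k * m = x.1 ∧ k • c = (x.2 : A ⧸ K) := by
  simp [intExtension, mem_zmultiples_iff, Prod.ext_iff]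

lemma comap_intExtension (K : AddSubgroup A) {m : ℕ} (hm : m ≠ 0) (c : A ⧸ K) :
    (intExtension K m c).comap (AddMonoidHom.inr ℤ A) = K := by
  ext a
  simp only [mem_comap, mem_intExtension, AddMonoidHom.inr_apply, mul_eq_zero, Nat.cast_eq_zero,
    hm, or_false, exists_eq_left, zero_smul]
  rw [eq_comm, QuotientAddGroup.eq_zero_iff]

lemma map_intExtension (K : AddSubgroup A) (m : ℕ) (c : A ⧸ K) :
    (intExtension K m c).map (AddMonoidHom.fst ℤ A) = zmultiples (m : ℤ) := by
  ext z
  simp only [mem_map, mem_intExtension, mem_zmultiples_iff, AddMonoidHom.coe_fst, smul_eq_mul]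
  constructor
  · rintro ⟨x, ⟨k, hk, -⟩, rfl⟩
    exact ⟨k, hk⟩
  · rintro ⟨k, rfl⟩
    obtain ⟨a, ha⟩ := QuotientAddGroup.mk_surjective (k • c)
    exact ⟨(k * m, a), ⟨k, rfl, ha.symm⟩, rfl⟩

lemma index_intExtension (K : AddSubgroup A) {m : ℕ} (hm : m ≠ 0) (c : A ⧸ K) :
    (intExtension K m c).index = K.index * m := by
  rw [index_eq_mul_of_int_prod, comap_intExtension K hm, map_intExtension, Int.index_zmultiples,
    Int.natAbs_natCast]

lemma intExtension_right_injective (K : AddSubgroup A) {m : ℕ} (hm : m ≠ 0) :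
    Function.Injective (intExtension K m) := by
  intro c c' h
  obtain ⟨a, rfl⟩ := QuotientAddGroup.mk_surjective c
  have hmem : ((m : ℤ), a) ∈ intExtension K m a := mem_intExtension.2 ⟨1, by simp⟩
  rw [h, mem_intExtension] at hmem
  obtain ⟨k, hk, hkc⟩ := hmem
  obtain rfl : k = 1 := by simpa [hm] using hk
  simpa using hkc.symm

lemma exists_intExtension_eq (H : AddSubgroup (ℤ × A)) :
    ∃ c, intExtension (H.comap (AddMonoidHom.inr ℤ A)) (H.map (AddMonoidHom.fst ℤ A)).index c =
      H := by
  set m := (H.map (AddMonoidHom.fst ℤ A)).index with hm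
  have hmap : H.map (AddMonoidHom.fst ℤ A) = zmultiples (m : ℤ) := eq_zmultiples_index _
  obtain ⟨⟨z, a⟩, ha, rfl : z = m⟩ : (m : ℤ) ∈ H.map (AddMonoidHom.fst ℤ A) :=
    hmap ▸ mem_zmultiples _
  refine ⟨(a : A ⧸ _), ?_⟩
  have key (x : ℤ × A) (k : ℤ) (hk : k * m = x.1) :
      k • (a : A ⧸ H.comap (AddMonoidHom.inr ℤ A)) = (x.2 : A ⧸ _) ↔ x ∈ H := by
    rw [← QuotientAddGroup.mk_zsmul, QuotientAddGroup.eq, mem_comap,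
      ← H.add_mem_cancel_left (H.zsmul_mem ha k) (y := AddMonoidHom.inr ℤ A _)]
    convert Iff.rfl using 2
    ext <;> simp [hk]
  ext x
  rw [mem_intExtension]
  constructor
  · rintro ⟨k, hk, hkx⟩
    exact (key x k hk).1 hkx
  · intro hx
    obtain ⟨k, hk⟩ := mem_zmultiples_iff.1 (hmap ▸ mem_map_of_mem (AddMonoidHom.fst ℤ A) hx)
    exact ⟨k, hk, (key x k hk).2 hx⟩

/-- A subgroup of `ℤ × A` of index `n ≠ 0` is determined by a factorization `n = d * m`, a subgroup
`K` of `A` of index `d` and an element of `A ⧸ K`. -/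
noncomputable def intProdIndexEquiv {n : ℕ} (hn : n ≠ 0) :
    (Σ p : n.divisorsAntidiagonal, Σ K : {K : AddSubgroup A // K.index = p.1.1}, A ⧸ K.1) ≃
      {H : AddSubgroup (ℤ × A) // H.index = n} :=
  Equiv.ofBijective
    (fun x ↦ ⟨intExtension x.2.1.1 x.1.1.2 x.2.2, by
      have h := Nat.mem_divisorsAntidiagonal.1 x.1.2
      rw [index_intExtension _ (right_ne_zero_of_mul (h.1 ▸ h.2)), x.2.1.2, h.1]⟩) <| by
    constructor
    · rintro ⟨⟨⟨d, m⟩, hp⟩, ⟨K, hK⟩, c⟩ ⟨⟨⟨d', m'⟩, hp'⟩, ⟨K', hK'⟩, c'⟩ h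
      have hm : m ≠ 0 := (Nat.ne_zero_of_mem_divisorsAntidiagonal hp).2
      have hm' : m' ≠ 0 := (Nat.ne_zero_of_mem_divisorsAntidiagonal hp').2
      replace h : intExtension K m c = intExtension K' m' c' := congrArg Subtype.val h
      obtain rfl : K = K' := by
        rw [← comap_intExtension K hm c, h, comap_intExtension K' hm' c']
      obtain rfl : m = m' := by
        have := congrArg (fun H ↦ (H.map (AddMonoidHom.fst ℤ A)).index) h
        simpa [map_intExtension, Int.index_zmultiples] using this
      obtain rfl := intExtension_right_injective K hm h
      dsimp only at hK hK'
      subst hK hK'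
      rfl
    · rintro ⟨H, rfl⟩
      obtain ⟨c, hc⟩ := exists_intExtension_eq H
      exact ⟨⟨⟨(_, _), Nat.mem_divisorsAntidiagonal.2 ⟨(index_eq_mul_of_int_prod H).symm, hn⟩⟩,
        ⟨_, rfl⟩, c⟩, Subtype.ext hc⟩

/-- The choices of a subgroup of index `d ≠ 0` together with a coset of it. -/
noncomputable def sigmaQuotientEquiv {d : ℕ} (hd : d ≠ 0) :
    (Σ K : {K : AddSubgroup A // K.index = d}, A ⧸ K.1) ≃
      {K : AddSubgroup A // K.index = d} × Fin d :=
  (Equiv.sigmaCongrRight fun K : {K : AddSubgroup A // K.index = d} ↦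
    (Nat.equivFinOfCardPos (α := A ⧸ K.1) (K.2.trans_ne hd)).trans (finCongr K.2)).trans
      (Equiv.sigmaEquivProd _ _)

lemma finite_sigma_quotient (hA : ∀ d ≠ 0, Finite {K : AddSubgroup A // K.index = d})
    {d : ℕ} (hd : d ≠ 0) : Finite (Σ K : {K : AddSubgroup A // K.index = d}, A ⧸ K.1) :=
  have := hA d hd
  .of_equiv _ (sigmaQuotientEquiv hd).symm

lemma finite_index_eq_int_prod (hA : ∀ d ≠ 0, Finite {K : AddSubgroup A // K.index = d})
    {n : ℕ} (hn : n ≠ 0) : Finite {H : AddSubgroup (ℤ × A) // H.index = n} :=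
  have (p : n.divisorsAntidiagonal) :=
    finite_sigma_quotient hA (Nat.ne_zero_of_mem_divisorsAntidiagonal p.2).1
  .of_equiv _ (intProdIndexEquiv hn)

lemma indexCount_int_prod (hA : ∀ d ≠ 0, Finite {K : AddSubgroup A // K.index = d})
    {n : ℕ} (hn : n ≠ 0) :
    indexCount (ℤ × A) n = ∑ p ∈ n.divisorsAntidiagonal, indexCount A p.1 * p.1 := by
  have (p : n.divisorsAntidiagonal) :=
    finite_sigma_quotient hA (Nat.ne_zero_of_mem_divisorsAntidiagonal p.2).1
  rw [indexCount, ← Nat.card_congr (intProdIndexEquiv hn), Nat.card_sigma,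
    ← Finset.sum_coe_sort n.divisorsAntidiagonal]
  refine Finset.sum_congr rfl fun p _ ↦ ?_
  rw [Nat.card_congr (sigmaQuotientEquiv (Nat.ne_zero_of_mem_divisorsAntidiagonal p.2).1),
    Nat.card_prod, Nat.card_fin, indexCount]

end Extension

/-- Splitting off the first coordinate of `ℤ ^ (ℓ + 1)`. -/
def consIntEquiv (ℓ : ℕ) : ℤ × (Fin ℓ → ℤ) ≃+ (Fin (ℓ + 1) → ℤ) :=
  (Fin.consLinearEquiv ℤ fun _ : Fin (ℓ + 1) ↦ ℤ).toAddEquiv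

lemma finite_index_eq_int_pow (ℓ : ℕ) :
    ∀ n ≠ 0, Finite {H : AddSubgroup (Fin ℓ → ℤ) // H.index = n} := by
  induction ℓ with
  | zero => exact fun _ _ ↦ inferInstance
  | succ ℓ ih =>
    intro n hn
    have := finite_index_eq_int_prod ih hn
    exact .of_equiv _ (indexEquiv (consIntEquiv ℓ) n)

lemma indexCount_int_pow_zero (n : ℕ) : indexCount (Fin 0 → ℤ) n = if n = 1 then 1 else 0 := by
  have hindex (H : AddSubgroup (Fin 0 → ℤ)) : H.index = 1 := by
    rw [index_eq_one]
    exact Subsingleton.elim _ _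
  split_ifs with h
  · subst h
    have : Unique {H : AddSubgroup (Fin 0 → ℤ) // H.index = 1} :=
      ⟨⟨⟨⊤, hindex ⊤⟩⟩, fun _ ↦ Subtype.ext (Subsingleton.elim _ _)⟩
    exact Nat.card_unique
  · have : IsEmpty {H : AddSubgroup (Fin 0 → ℤ) // H.index = n} :=
      ⟨fun H ↦ h (H.2.symm.trans (hindex H.1))⟩
    exact Nat.card_of_isEmpty

lemma indexCount_int_pow_succ (ℓ : ℕ) {n : ℕ} (hn : n ≠ 0) :
    indexCount (Fin (ℓ + 1) → ℤ) n =
      ∑ p ∈ n.divisorsAntidiagonal, indexCount (Fin ℓ → ℤ) p.1 * p.1 := by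
  rw [← indexCount_int_prod (finite_index_eq_int_pow ℓ) hn]
  exact (Nat.card_congr (indexEquiv (consIntEquiv ℓ) n)).symm

end AddSubgroup

open AddSubgroup

lemma LSeriesHasSum.mul_natCast {f : ℕ → ℂ} {s a : ℂ} (hf : LSeriesHasSum f (s - 1) a) :
    LSeriesHasSum (fun n ↦ f n * n) s a := by
  refine HasSum.congr_fun hf fun n ↦ ?_
  rcases eq_or_ne n 0 with rfl | hn
  · simp
  · have hn' : (n : ℂ) ≠ 0 := Nat.cast_ne_zero.2 hn
    rw [LSeries.term_of_ne_zero hn, LSeries.term_of_ne_zero hn, Complex.cpow_sub _ _ hn',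
      Complex.cpow_one]
    field_simp

lemma LSeriesHasSum_indexCount_int_pow (ℓ : ℕ) {s : ℂ} (hs : (ℓ : ℝ) < s.re) :
    LSeriesHasSum (fun n ↦ (indexCount (Fin ℓ → ℤ) n : ℂ)) s
      (∏ j ∈ Finset.range ℓ, riemannZeta (s - j)) := by
  induction ℓ generalizing s with
  | zero =>
    have hterm : LSeries.term (fun n ↦ (indexCount (Fin 0 → ℤ) n : ℂ)) s =
        fun n ↦ if n = 1 then 1 else 0 := by
      rw [← funext (LSeries.term_delta s)]
      congr 1
      ext n
      simp [indexCount_int_pow_zero, LSeries.delta]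
    rw [LSeriesHasSum, hterm]
    simpa using hasSum_ite_eq (1 : ℕ) (1 : ℂ)
  | succ ℓ ih =>
    push_cast at hs
    have hmul := (ih (s := s - 1) (by simpa using by linarith)).mul_natCast.convolution
      (LSeriesHasSum_one (s := s) (by linarith [(Nat.cast_nonneg ℓ : (0 : ℝ) ≤ ℓ)]))
    rw [Finset.prod_range_succ']
    convert (LSeriesHasSum_congr s _ fun {n} hn ↦ ?_).1 hmul using 1
    · simp [sub_sub, add_comm]
    · rw [LSeries.convolution_def]
      simp [indexCount_int_pow_succ ℓ hn]

theorem zeta_of_Z_pow_ell (ℓ : ℕ) (hℓ : 1 ≤ ℓ) (s : ℂ) (hs : (ℓ : ℝ) < s.re) :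
    (Summable fun n : ℕ =>
      ‖(Nat.card {H : AddSubgroup (Fin ℓ → ℤ) // H.index = n + 1} : ℂ) *
        ((n + 1 : ℕ) : ℂ) ^ (-s)‖) ∧
    ∑' n : ℕ,
        (Nat.card {H : AddSubgroup (Fin ℓ → ℤ) // H.index = n + 1} : ℂ) *
          ((n + 1 : ℕ) : ℂ) ^ (-s) =
      ∏ j ∈ Finset.range ℓ, riemannZeta (s - j) := by
  have hsum : HasSum (fun n : ℕ =>
      (Nat.card {H : AddSubgroup (Fin ℓ → ℤ) // H.index = n + 1} : ℂ) *
        ((n + 1 : ℕ) : ℂ) ^ (-s)) (∏ j ∈ Finset.range ℓ, riemannZeta (s - j)) := by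
    have h := (hasSum_nat_add_iff' 1).2 (LSeriesHasSum_indexCount_int_pow ℓ hs)
    simp only [Finset.range_one, Finset.sum_singleton, LSeries.term_zero, sub_zero] at h
    refine h.congr_fun fun n ↦ ?_
    rw [LSeries.term_of_ne_zero n.succ_ne_zero, Complex.cpow_neg, ← div_eq_mul_inv]
    rfl
  exact ⟨hsum.summable.norm, hsum.tsum_eq⟩
end

section
/- Let G be a finitely generated group and n ≥ 1 an integer. Then the number of group homomorphisms φ : G → Equiv.Perm (Fin n) for which the induced action of G on Fin n is transitive (MulAction.IsPretransitive) equals (n−1)! · a_n(G). -/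
/-- Bijections with a prescribed value at one point are a torsor under the permutations
of the other points. -/
noncomputable def Equiv.pointedEquivPerm {Q X : Type*} [DecidableEq X] {q : Q} {x : X}
    (e₀ : Q ≃ X) (h₀ : e₀ q = x) :
    {e : Q ≃ X // e q = x} ≃ Equiv.Perm {y : X // y ≠ x} :=
  (Equiv.subtypeEquiv (q := fun f : Equiv.Perm X => ∀ a, ¬ a ≠ x → f a = a)
    (Equiv.equivCongr e₀ (Equiv.refl X)) (by
      intro e
      simp [Equiv.equivCongr, ← h₀])).trans
    (Equiv.Perm.subtypeEquivSubtypePerm (fun y : X => y ≠ x)).symm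

theorem Equiv.exists_apply_eq_of_natCard_eq {Q X : Type*} [Finite X] (q : Q) (x : X)
    (h : Nat.card Q = Nat.card X) : ∃ e : Q ≃ X, e q = x := by
  classical
  have : Nonempty X := ⟨x⟩
  have : Finite Q := Nat.finite_of_card_ne_zero (h ▸ Nat.card_pos.ne')
  obtain ⟨e⟩ := Finite.card_eq.mp h
  exact ⟨e.trans (Equiv.swap (e q) x), by simp⟩

/-- The permutation representation on `X` obtained by transporting the action on `G ⧸ H`. -/
def Subgroup.permHomOfEquiv {G X : Type*} [Group G] (H : Subgroup G) (e : G ⧸ H ≃ X) :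
    G →* Equiv.Perm X :=
  e.permCongrHom.toMonoidHom.comp (MulAction.toPermHom G (G ⧸ H))

theorem Subgroup.permHomOfEquiv_apply {G X : Type*} [Group G] (H : Subgroup G) (e : G ⧸ H ≃ X)
    (g : G) (y : G ⧸ H) : H.permHomOfEquiv e g (e y) = e (g • y) := by
  simp [permHomOfEquiv, Equiv.permCongrHom]

theorem Subgroup.permHomOfEquiv_transitive {G X : Type*} [Group G] (H : Subgroup G)
    (e : G ⧸ H ≃ X) (i j : X) : ∃ g, H.permHomOfEquiv e g i = j := by
  obtain ⟨g, hg⟩ := MulAction.exists_smul_eq G (e.symm i) (e.symm j)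
  refine ⟨g, ?_⟩
  rw [← e.apply_symm_apply i, permHomOfEquiv_apply, hg, e.apply_symm_apply]

theorem Subgroup.permHomOfEquiv_basepoint {G X : Type*} [Group G] (H : Subgroup G) {x : X}
    {e : G ⧸ H ≃ X} (h : e ((1 : G) : G ⧸ H) = x) (g : G) :
    H.permHomOfEquiv e g x = e (g : G ⧸ H) := by
  rw [← h, permHomOfEquiv_apply, MulAction.Quotient.smul_coe, smul_eq_mul, mul_one]

theorem Subgroup.mem_iff_permHomOfEquiv {G X : Type*} [Group G] (H : Subgroup G) {x : X}
    {e : G ⧸ H ≃ X} (h : e ((1 : G) : G ⧸ H) = x) (g : G) :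
    g ∈ H ↔ H.permHomOfEquiv e g x = x := by
  rw [permHomOfEquiv_basepoint H h, ← h, e.apply_eq_iff_eq, eq_comm, QuotientGroup.eq]
  simp

theorem exists_permHomOfEquiv_eq {G X : Type*} [Group G] (x : X) (φ : G →* Equiv.Perm X)
    (hφ : ∀ i j, ∃ g, φ g i = j) :
    ∃ (H : Subgroup G) (e : G ⧸ H ≃ X), e ((1 : G) : G ⧸ H) = x ∧ H.permHomOfEquiv e = φ := by
  let _ : MulAction G X := MulAction.compHom X φ
  have hsurj : Function.Surjective (MulAction.ofQuotientStabilizer G x) := fun y =>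
    let ⟨g, hg⟩ := hφ x y
    ⟨(g : G ⧸ MulAction.stabilizer G x), hg⟩
  let e := Equiv.ofBijective _ ⟨MulAction.injective_ofQuotientStabilizer G x, hsurj⟩
  refine ⟨_, e, one_smul G x, ?_⟩
  ext g y
  obtain ⟨q, rfl⟩ := e.surjective y
  rw [Subgroup.permHomOfEquiv_apply]
  exact MulAction.ofQuotientStabilizer_smul G x g q

theorem natCard_transitive_permHom {G X : Type*} [Group G] [Finite X] (x : X) :
    Nat.card {φ : G →* Equiv.Perm X // ∀ i j : X, ∃ g : G, φ g i = j} =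
      (Nat.card X - 1).factorial * Nat.card {H : Subgroup G // H.index = Nat.card X} := by
  classical
  let F : (Σ H : {H : Subgroup G // H.index = Nat.card X},
      {e : G ⧸ H.1 ≃ X // e ((1 : G) : G ⧸ H.1) = x}) →
      {φ : G →* Equiv.Perm X // ∀ i j : X, ∃ g : G, φ g i = j} :=
    fun p => ⟨p.1.1.permHomOfEquiv p.2.1, p.1.1.permHomOfEquiv_transitive p.2.1⟩
  have hF : Function.Bijective F := by
    constructor
    · rintro ⟨⟨H, hH⟩, e, he⟩ ⟨⟨K, hK⟩, f, hf⟩ h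
      replace h : H.permHomOfEquiv e = K.permHomOfEquiv f := congrArg Subtype.val h
      obtain rfl : H = K := by
        ext g
        rw [H.mem_iff_permHomOfEquiv he, K.mem_iff_permHomOfEquiv hf, h]
      obtain rfl : e = f := by
        ext q
        induction q using QuotientGroup.induction_on with
        | H g => rw [← H.permHomOfEquiv_basepoint he, ← H.permHomOfEquiv_basepoint hf, h]
      rfl
    · rintro ⟨φ, hφ⟩
      obtain ⟨H, e, he, rfl⟩ := exists_permHomOfEquiv_eq x φ hφ
      exact ⟨⟨⟨H, Nat.card_congr e⟩, e, he⟩, rfl⟩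
  choose e₀ he₀ using fun H : {H : Subgroup G // H.index = Nat.card X} =>
    Equiv.exists_apply_eq_of_natCard_eq ((1 : G) : G ⧸ H.1) x H.2
  have hcard : Nat.card {y : X // y ≠ x} = Nat.card X - 1 := by
    have := Fintype.ofFinite X
    simp [Nat.card_eq_fintype_card, Fintype.card_subtype_compl]
  rw [← Nat.card_congr (Equiv.ofBijective F hF),
    Nat.card_congr ((Equiv.sigmaCongrRight fun H => Equiv.pointedEquivPerm (e₀ H) (he₀ H)).trans
      (Equiv.sigmaEquivProd _ _)), Nat.card_prod, Nat.card_perm, hcard, mul_comm]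

theorem transitive_hom_count
    (G : Type*) [Group G] [Group.FG G] (n : ℕ) (hn : 1 ≤ n) :
    Nat.card {φ : G →* Equiv.Perm (Fin n) // ∀ i j : Fin n, ∃ g : G, φ g i = j} =
      (n - 1).factorial * Nat.card {H : Subgroup G // H.index = n} := by
  simpa only [Nat.card_fin] using natCard_transitive_permHom (G := G) (⟨0, hn⟩ : Fin n)
end

section
/- (Bantay's exponential formula, analytic form.) Let G be a finitely generated group whose subgroup counting function has polynomial growth: there exist C > 0 and d ≥ 0 with a_n(G) ≤ C·n^d for all n ≥ 1. Fix a real x > 0. Then for every complex z with |z| < 1, the series ∑_{δ=1}^{∞} a_δ(G)·z^δ/δ converges absolutely, the series ∑_{n=0}^{∞} H_{G,n}(x)·z^n converges absolutely, and ∑_{n=0}^{∞} H_{G,n}(x)·z^n = exp( x · ∑_{δ=1}^{∞} a_δ(G)·z^δ/δ ). -/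
open scoped BigOperators

/-- `a_n(G)`: the number of subgroups of `G` of index exactly `n`. -/
noncomputable def aCount (G : Type*) [Group G] (n : ℕ) : ℕ :=
  Nat.card {H : Subgroup G // H.index = n}

/-- `c(φ)`: the number of orbits of the action of `G` on `Fin n` induced by
`φ : G →* Equiv.Perm (Fin n)`. -/
noncomputable def numOrbits {G : Type*} [Group G] {n : ℕ} (φ : G →* Equiv.Perm (Fin n)) : ℕ :=
  Nat.card (Quotient (MulAction.orbitRel φ.range (Fin n)))

/-- `H_{G,n}(x) = (1/n!) ∑_{φ ∈ Hom(G, S_n)} x^{c(φ)}`. -/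
noncomputable def Hpoly (G : Type*) [Group G] (n : ℕ) (x : ℝ) : ℝ :=
  (∑ᶠ φ : G →* Equiv.Perm (Fin n), x ^ numOrbits φ) / (Nat.factorial n : ℝ)

section Orbits

variable {G α β : Type*} [Group G]

/-- The number of orbits of the action of `G` on `α` given by `φ`. -/
noncomputable def orbitCount (φ : G →* Equiv.Perm α) : ℕ :=
  Nat.card (Quotient (MulAction.orbitRel φ.range α))

theorem orbitRel_range_iff (φ : G →* Equiv.Perm α) (a b : α) :
    MulAction.orbitRel φ.range α a b ↔ ∃ g, φ g b = a := by
  rw [MulAction.orbitRel_apply, MulAction.mem_orbit_iff]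
  constructor
  · rintro ⟨⟨_, g, rfl⟩, h⟩
    exact ⟨g, h⟩
  · rintro ⟨g, h⟩
    exact ⟨⟨_, g, rfl⟩, h⟩

theorem orbitCount_permCongr (e : α ≃ β) (φ : G →* Equiv.Perm α) :
    orbitCount (e.permCongrHom.toMonoidHom.comp φ) = orbitCount φ := by
  refine (Nat.card_congr (Quotient.congr e fun a b => ?_)).symm
  rw [orbitRel_range_iff, orbitRel_range_iff]
  simp [Equiv.permCongrHom]

variable (G α) in
/-- The orbit-counting sum over all actions of `G` on `α`. -/
noncomputable def homSum (x : ℝ) : ℝ :=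
  ∑ᶠ φ : G →* Equiv.Perm α, x ^ orbitCount φ

theorem homSum_congr (e : α ≃ β) (x : ℝ) : homSum G α x = homSum G β x := by
  refine finsum_eq_of_bijective (fun φ => e.permCongrHom.toMonoidHom.comp φ) ⟨?_, ?_⟩ ?_
  · intro φ ψ h
    ext1 g
    exact e.permCongrHom.injective (DFunLike.congr_fun h g)
  · intro ψ
    refine ⟨e.permCongrHom.symm.toMonoidHom.comp ψ, ?_⟩
    ext1 g
    exact e.permCongrHom.apply_symm_apply (ψ g)
  · intro φ
    rw [orbitCount_permCongr]

open Classical in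
/-- Extend an action on the complement of an embedded coset space by the coset action. -/
noncomputable def glue (H : Subgroup G) (f : G ⧸ H ↪ α)
    (ψ : G →* Equiv.Perm ↥(Set.range f)ᶜ) : G →* Equiv.Perm α :=
  (((Equiv.ofInjective f f.injective).sumCongr (Equiv.refl _)).trans
    (Equiv.Set.sumCompl (Set.range f))).permCongrHom.toMonoidHom.comp
      ((Equiv.Perm.sumCongrHom _ _).comp ((MulAction.toPermHom G (G ⧸ H)).prod ψ))

theorem glue_apply_range (H : Subgroup G) (f : G ⧸ H ↪ α)
    (ψ : G →* Equiv.Perm ↥(Set.range f)ᶜ) (g : G) (q : G ⧸ H) :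
    glue H f ψ g (f q) = f (g • q) := by
  classical
  have h : (Equiv.Set.sumCompl (Set.range f)).symm (f q) = Sum.inl ⟨f q, q, rfl⟩ :=
    Equiv.Set.sumCompl_symm_apply_of_mem (Set.mem_range_self q)
  have h' : (Equiv.ofInjective f f.injective).symm ⟨f q, q, rfl⟩ = q :=
    Equiv.ofInjective_symm_apply f.injective q
  simp [glue, Equiv.permCongrHom, h, h']

theorem glue_apply_compl (H : Subgroup G) (f : G ⧸ H ↪ α)
    (ψ : G →* Equiv.Perm ↥(Set.range f)ᶜ) (g : G) (y : ↥(Set.range f)ᶜ) :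
    glue H f ψ g y = ψ g y := by
  classical
  have h : (Equiv.Set.sumCompl (Set.range f)).symm y = Sum.inr y :=
    Equiv.Set.sumCompl_symm_apply_of_notMem y.2
  simp [glue, Equiv.permCongrHom, h]

theorem orbitCount_glue [Finite α] (H : Subgroup G) (f : G ⧸ H ↪ α)
    (ψ : G →* Equiv.Perm ↥(Set.range f)ᶜ) :
    orbitCount (glue H f ψ) = orbitCount ψ + 1 := by
  let F : Option (Quotient (MulAction.orbitRel ψ.range ↥(Set.range f)ᶜ)) →
      Quotient (MulAction.orbitRel (glue H f ψ).range α) := fun o => o.elim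
    (Quotient.mk _ (f (1 : G)))
    (Quotient.lift (fun y => Quotient.mk _ (y : α)) fun a b hab => Quotient.sound (by
      obtain ⟨g, hg⟩ := (orbitRel_range_iff ψ a b).1 hab
      exact (orbitRel_range_iff _ _ _).2 ⟨g, by rw [glue_apply_compl, hg]⟩))
  have hF : Function.Bijective F := by
    constructor
    · rintro (_ | p) (_ | q) h
      · rfl
      · induction q using Quotient.inductionOn with | _ y
        obtain ⟨g, hg⟩ := (orbitRel_range_iff _ _ _).1 (Quotient.exact h.symm)
        rw [glue_apply_range] at hg
        exact absurd ⟨_, hg⟩ y.2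
      · induction p using Quotient.inductionOn with | _ y
        obtain ⟨g, hg⟩ := (orbitRel_range_iff _ _ _).1 (Quotient.exact h)
        rw [glue_apply_range] at hg
        exact absurd ⟨_, hg⟩ y.2
      · induction p using Quotient.inductionOn with | _ y
        induction q using Quotient.inductionOn with | _ y'
        obtain ⟨g, hg⟩ := (orbitRel_range_iff _ _ _).1 (Quotient.exact h)
        rw [glue_apply_compl] at hg
        exact congrArg some (Quotient.sound
          ((orbitRel_range_iff _ _ _).2 ⟨g, Subtype.ext hg⟩))
    · intro p
      induction p using Quotient.inductionOn with | _ a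
      by_cases ha : a ∈ Set.range f
      · obtain ⟨q, rfl⟩ := ha
        induction q using QuotientGroup.induction_on with | _ g
        refine ⟨none, Quotient.sound ((orbitRel_range_iff _ _ _).2 ⟨g⁻¹, ?_⟩)⟩
        rw [glue_apply_range, MulAction.Quotient.smul_coe, smul_eq_mul, inv_mul_cancel]
      · exact ⟨some (Quotient.mk _ ⟨a, ha⟩), rfl⟩
  rw [orbitCount, ← Nat.card_congr (Equiv.ofBijective F hF), Finite.card_option, orbitCount]

theorem mem_of_glue_eq (H : Subgroup G) (f : G ⧸ H ↪ α)
    (ψ : G →* Equiv.Perm ↥(Set.range f)ᶜ) (g : G) :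
    g ∈ H ↔ glue H f ψ g (f (1 : G)) = f (1 : G) := by
  rw [glue_apply_range, f.injective.eq_iff, MulAction.Quotient.smul_coe, eq_comm,
    QuotientGroup.eq]
  simp

variable (G α) in
/-- Data of a coset space of size at most `n` embedded in `α` with an action on its complement. -/
abbrev GlueData (n : ℕ) : Type _ :=
  Σ k : Fin n, Σ H : {H : Subgroup G // H.index = k + 1}, Σ f : (G ⧸ H.1) ↪ α,
    G →* Equiv.Perm ↥(Set.range f)ᶜ

/-- The action on `α` with a distinguished point encoded by gluing data. -/
noncomputable def GlueData.pointedAction {n : ℕ} (d : GlueData G α n) :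
    (G →* Equiv.Perm α) × α :=
  (glue d.2.1.1 d.2.2.1 d.2.2.2, d.2.2.1 (1 : G))

theorem pointedAction_injective (n : ℕ) :
    Function.Injective (GlueData.pointedAction : GlueData G α n → _) := by
  rintro ⟨k, ⟨H, hH⟩, f, ψ⟩ ⟨k', ⟨H', hH'⟩, f', ψ'⟩ h
  obtain ⟨h1, h2⟩ := Prod.mk.inj h
  dsimp only at h1 h2
  obtain rfl : H = H' := by
    ext g
    rw [mem_of_glue_eq H f ψ, mem_of_glue_eq H' f' ψ', h1, h2]
  obtain rfl : k = k' := Fin.ext (by omega)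
  obtain rfl : f = f' := by
    ext q
    induction q using QuotientGroup.induction_on with | _ g
    have h3 : ((g : G) : G ⧸ H) = g • ((1 : G) : G ⧸ H) := by
      rw [MulAction.Quotient.smul_coe, smul_eq_mul, mul_one]
    rw [h3, ← glue_apply_range H f ψ, ← glue_apply_range H f' ψ', h1, h2]
  obtain rfl : ψ = ψ' := by
    ext g y
    rw [← glue_apply_compl H f ψ, ← glue_apply_compl H f ψ', h1]
  rfl

theorem pointedAction_surjective [Finite α] {n : ℕ} (hn : Nat.card α = n) :
    Function.Surjective (GlueData.pointedAction : GlueData G α n → _) := by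
  rintro ⟨φ, a⟩
  let : MulAction G α := MulAction.compHom α φ
  let H := MulAction.stabilizer G a
  let f : G ⧸ H ↪ α :=
    ⟨MulAction.ofQuotientStabilizer G a, MulAction.injective_ofQuotientStabilizer G a⟩
  have hf : ∀ g : G, f (g : G ⧸ H) = φ g a := fun _ => rfl
  have hfg : ∀ (g : G) (q : G ⧸ H), f (g • q) = φ g (f q) := by
    intro g q
    induction q using QuotientGroup.induction_on with | _ g'
    rw [MulAction.Quotient.smul_coe, hf, hf, smul_eq_mul, map_mul, Equiv.Perm.mul_apply]
  have hstab : ∀ (g : G) (b : α), φ g b ∈ (Set.range f)ᶜ ↔ b ∈ (Set.range f)ᶜ := by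
    intro g b
    refine not_congr ⟨?_, ?_⟩
    · rintro ⟨q, hq⟩
      exact ⟨g⁻¹ • q, by rw [hfg, hq, map_inv]; exact (φ g).symm_apply_apply b⟩
    · rintro ⟨q, rfl⟩
      exact ⟨g • q, hfg g q⟩
  let ψ : G →* Equiv.Perm ↥(Set.range f)ᶜ :=
    { toFun := fun g => (φ g).subtypePerm (hstab g)
      map_one' := by ext; simp
      map_mul' := fun g g' => Equiv.ext fun b =>
        Subtype.ext (DFunLike.congr_fun (map_mul φ g g') b.1) }
  have : Finite (G ⧸ H) := Finite.of_injective f f.injective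
  have hpos : 0 < H.index := by rw [Subgroup.index]; exact Nat.card_pos
  have hle : H.index ≤ Nat.card α := Nat.card_le_card_of_injective f f.injective
  rw [hn] at hle
  refine ⟨⟨⟨H.index - 1, by omega⟩, ⟨H, by simp only; omega⟩, f, ψ⟩, ?_⟩
  refine Prod.ext ?_ ?_
  · ext g b
    by_cases hb : b ∈ Set.range f
    · obtain ⟨q, rfl⟩ := hb
      exact (glue_apply_range H f ψ g q).trans (hfg g q)
    · exact glue_apply_compl H f ψ g ⟨b, hb⟩
  · exact (hf 1).trans (by rw [map_one, Equiv.Perm.one_apply])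

variable (G) in
theorem finite_hom [Group.FG G] (M : Type*) [Group M] [Finite M] : Finite (G →* M) := by
  obtain ⟨S, hS⟩ := Group.fg_def.1 ‹Group.FG G›
  refine Finite.of_injective (fun (φ : G →* M) (s : S) => φ s) fun φ ψ h => ?_
  exact MonoidHom.eq_of_eqOn_dense hS fun s hs => congr_fun h ⟨s, hs⟩

theorem finite_index_eq [Group.FG G] (n : ℕ) :
    Finite {H : Subgroup G // H.index = n + 1} := by
  have := finite_hom G (Equiv.Perm (Fin (n + 1)))
  have key : ∀ H : {H : Subgroup G // H.index = n + 1}, Nonempty (G ⧸ H.1 ↪ Fin (n + 1)) := by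
    intro H
    have : Finite (G ⧸ H.1) := Nat.finite_of_card_ne_zero (by
      rw [← Subgroup.index, H.2]; omega)
    exact ⟨(Finite.equivFinOfCardEq H.2).toEmbedding⟩
  let f := fun H => (key H).some
  refine Finite.of_injective (β := (G →* Equiv.Perm (Fin (n + 1))) × Fin (n + 1))
    (fun H => (glue H.1 (f H) 1, f H (1 : G))) ?_
  intro H K h
  have h' := @pointedAction_injective G (Fin (n + 1)) _ (n + 1)
    ⟨Fin.last n, H, f H, 1⟩ ⟨Fin.last n, K, f K, 1⟩ h
  cases h'
  rfl

theorem card_quotient_embedding {n k : ℕ} [Finite α] (hα : Nat.card α = n) {H : Subgroup G}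
    (hH : H.index = k + 1) : Nat.card (G ⧸ H ↪ α) = n.descFactorial (k + 1) := by
  have : Finite (G ⧸ H) := Nat.finite_of_card_ne_zero (by rw [← Subgroup.index, hH]; omega)
  have := Fintype.ofFinite (G ⧸ H)
  have := Fintype.ofFinite α
  have := Fintype.ofFinite (G ⧸ H ↪ α)
  rw [Nat.card_eq_fintype_card, Fintype.card_embedding_eq, ← Nat.card_eq_fintype_card,
    ← Nat.card_eq_fintype_card, hα, ← Subgroup.index, hH]

theorem finsum_pow_orbitCount_glue [Group.FG G] {n k : ℕ} [Finite α] (hα : Nat.card α = n)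
    {H : Subgroup G} (hH : H.index = k) (f : G ⧸ H ↪ α) (x : ℝ) :
    ∑ᶠ ψ : G →* Equiv.Perm ↥(Set.range f)ᶜ, x ^ orbitCount (glue H f ψ) =
      x * homSum G (Fin (n - k)) x := by
  have hcard : Nat.card ↥(Set.range f)ᶜ = n - k := by
    rw [Nat.card_coe_set_eq, Set.ncard_compl, hα, ← Nat.card_coe_set_eq,
      ← Nat.card_congr (Equiv.ofInjective f f.injective), ← Subgroup.index, hH]
  have := finite_hom G (Equiv.Perm ↥(Set.range f)ᶜ)
  rw [← homSum_congr (Finite.equivFinOfCardEq hcard), homSum, ← smul_eq_mul, smul_finsum]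
  simp only [orbitCount_glue, pow_succ', smul_eq_mul]

theorem finsum_const_eq_card_mul {ι : Type*} [Finite ι] {n : ℕ} (hn : Nat.card ι = n)
    {F : ι → ℝ} {c : ℝ} (h : ∀ i, F i = c) : ∑ᶠ i, F i = n * c := by
  have := Fintype.ofFinite ι
  simp [h, finsum_eq_sum_of_fintype, ← hn]

theorem finsum_sigma {ι : Type*} {κ : ι → Type*} [Finite ι] [∀ i, Finite (κ i)]
    (F : (Σ i, κ i) → ℝ) : ∑ᶠ p, F p = ∑ᶠ i, ∑ᶠ j, F ⟨i, j⟩ := by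
  have := Fintype.ofFinite ι
  have := fun i => Fintype.ofFinite (κ i)
  simp only [finsum_eq_sum_of_fintype, Fintype.sum_sigma]

theorem card_mul_homSum [Group.FG G] (m : ℕ) (x : ℝ) :
    (m + 1) * homSum G (Fin (m + 1)) x = ∑ k ∈ Finset.range (m + 1),
      aCount G (k + 1) * ((m + 1).descFactorial (k + 1) * (x * homSum G (Fin (m - k)) x)) := by
  have : ∀ (M : Type) [Group M] [Finite M], Finite (G →* M) := fun M _ _ => finite_hom G M
  have : ∀ n : ℕ, Finite {H : Subgroup G // H.index = n + 1} := finite_index_eq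
  have : ∀ (n : ℕ) (H : {H : Subgroup G // H.index = n + 1}), Finite (G ⧸ H.1) := fun n H =>
    Nat.finite_of_card_ne_zero (by rw [← Subgroup.index, H.2]; omega)
  have hsum : ∑ᶠ d : GlueData G (Fin (m + 1)) (m + 1), x ^ orbitCount d.pointedAction.1 =
      ∑ᶠ p : (G →* Equiv.Perm (Fin (m + 1))) × Fin (m + 1), x ^ orbitCount p.1 :=
    finsum_eq_of_bijective _
      ⟨pointedAction_injective _, pointedAction_surjective (Nat.card_fin _)⟩ fun _ => rfl
  have hl : (m + 1) * homSum G (Fin (m + 1)) x =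
      ∑ᶠ p : (G →* Equiv.Perm (Fin (m + 1))) × Fin (m + 1), x ^ orbitCount p.1 := by
    have := Fintype.ofFinite (G →* Equiv.Perm (Fin (m + 1)))
    rw [homSum, finsum_eq_sum_of_fintype, finsum_eq_sum_of_fintype, Fintype.sum_prod_type,
      Finset.mul_sum]
    simp
  rw [hl, ← hsum, Finset.sum_range, ← finsum_eq_sum_of_fintype]
  refine (finsum_sigma _).trans (finsum_congr fun k => ?_)
  refine (finsum_sigma _).trans (finsum_const_eq_card_mul rfl fun H => ?_)
  refine (finsum_sigma _).trans (finsum_const_eq_card_mul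
    (card_quotient_embedding (Nat.card_fin _) H.2) fun f => ?_)
  have h := finsum_pow_orbitCount_glue (Nat.card_fin (m + 1)) H.2 f x
  rwa [Nat.add_sub_add_right] at h

theorem Hpoly_eq_homSum (n : ℕ) (x : ℝ) :
    Hpoly G n x = homSum G (Fin n) x / n.factorial := rfl

theorem Hpoly_zero (x : ℝ) : Hpoly G 0 x = 1 := by
  have h : ∀ φ : G →* Equiv.Perm (Fin 0), x ^ numOrbits φ = 1 := fun φ => by
    have : numOrbits φ = 0 := by
      rw [numOrbits]
      have : IsEmpty (Quotient (MulAction.orbitRel φ.range (Fin 0))) :=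
        ⟨fun q => q.inductionOn fun a => a.elim0⟩
      exact Nat.card_of_isEmpty
    rw [this, pow_zero]
  have : Unique (G →* Equiv.Perm (Fin 0)) :=
    ⟨⟨1⟩, fun φ => by ext g a; exact a.elim0⟩
  simp [Hpoly, h, finsum_unique]

theorem succ_mul_Hpoly_succ [Group.FG G] (m : ℕ) (x : ℝ) :
    (m + 1) * Hpoly G (m + 1) x =
      ∑ k ∈ Finset.range (m + 1), x * aCount G (k + 1) * Hpoly G (m - k) x := by
  rw [Hpoly_eq_homSum, ← mul_div_assoc, card_mul_homSum, Finset.sum_div]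
  refine Finset.sum_congr rfl fun k hk => ?_
  have hk' : k + 1 ≤ m + 1 := by simpa using hk
  have hf := Nat.factorial_mul_descFactorial hk'
  rw [Nat.add_sub_add_right] at hf
  rw [Hpoly_eq_homSum, ← hf]
  have h1 : ((m - k).factorial : ℝ) ≠ 0 := by positivity
  have h2 : ((m + 1).descFactorial (k + 1) : ℝ) ≠ 0 := by
    have : (m + 1).descFactorial (k + 1) ≠ 0 := by
      rw [Ne, Nat.descFactorial_eq_zero_iff_lt]; omega
    exact_mod_cast this
  push_cast
  field_simp

end Orbits

section Analysis

open scoped Nat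

theorem iteratedDeriv_eq_factorial_mul_coeff {b : ℕ → ℂ} {A : ℂ → ℂ}
    (hA : ∀ z : ℂ, ‖z‖ < 1 → HasSum (fun n => z ^ n * b n) (A z)) (n : ℕ) :
    iteratedDeriv n A 0 = n ! * b n := by
  have h : HasFPowerSeriesAt A (FormalMultilinearSeries.ofScalars ℂ b) 0 := by
    rw [hasFPowerSeriesAt_iff]
    filter_upwards [Metric.ball_mem_nhds (0 : ℂ) one_pos] with z hz
    simpa using hA z (by simpa using hz)
  obtain ⟨r, hr⟩ := h
  have := hr.factorial_smul 1 n
  rw [iteratedDeriv_eq_iteratedFDeriv]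
  simpa using this.symm

theorem differentiableOn_of_hasSum {b : ℕ → ℂ} {A : ℂ → ℂ}
    (hA : ∀ z : ℂ, ‖z‖ < 1 → HasSum (fun n => z ^ n * b n) (A z)) :
    DifferentiableOn ℂ A (Metric.ball 0 1) := by
  have hr : 1 ≤ (FormalMultilinearSeries.ofScalars ℂ b).radius := by
    refine ENNReal.le_of_forall_nnreal_lt fun r hr => ?_
    refine FormalMultilinearSeries.le_radius_of_summable _ ?_
    have hr' : r < 1 := by exact_mod_cast hr
    have := (hA (r : ℂ) (by simpa using hr')).summable.norm
    simpa [FormalMultilinearSeries.ofScalars_norm, mul_comm] using this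
  have h := ((FormalMultilinearSeries.ofScalars ℂ b).hasFPowerSeriesOnBall
    (one_pos.trans_le hr)).mono one_pos hr
  have hd := h.differentiableOn
  rw [← ENNReal.ofReal_one, Metric.eball_ofReal] at hd
  refine hd.congr fun z hz => ?_
  have hz' : ‖z‖ < 1 := by simpa using hz
  rw [FormalMultilinearSeries.sum, ← (hA z hz').tsum_eq]
  simp [mul_comm]

/-- A sequence satisfying the recurrence of the coefficients of `exp ∘ A` consists of these
coefficients. -/
theorem hasSum_exp_of_recurrence {b c : ℕ → ℂ} {A : ℂ → ℂ}
    (hA : ∀ z : ℂ, ‖z‖ < 1 → HasSum (fun n => z ^ n * b n) (A z)) (hb : b 0 = 0) (hc : c 0 = 1)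
    (hrec : ∀ m : ℕ, (m + 1) * c (m + 1) =
      ∑ k ∈ Finset.range (m + 1), (k + 1) * b (k + 1) * c (m - k))
    {z : ℂ} (hz : ‖z‖ < 1) : HasSum (fun n => z ^ n * c n) (Complex.exp (A z)) := by
  have hdA := differentiableOn_of_hasSum hA
  have hdE : DifferentiableOn ℂ (fun w => Complex.exp (A w)) (Metric.ball 0 1) := hdA.cexp
  have hnhds := Metric.ball_mem_nhds (0 : ℂ) one_pos
  have hsA : AnalyticAt ℂ A 0 := hdA.analyticAt hnhds
  have hsE : AnalyticAt ℂ (fun w => Complex.exp (A w)) 0 := hdE.analyticAt hnhds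
  have hderiv : deriv (fun w => Complex.exp (A w)) =ᶠ[nhds 0]
      deriv A * fun w => Complex.exp (A w) := by
    filter_upwards [hnhds] with w hw
    rw [deriv_cexp (hdA.differentiableAt (Metric.isOpen_ball.mem_nhds hw)), mul_comm]
    rfl
  have hcoeff : ∀ n, iteratedDeriv n (fun w => Complex.exp (A w)) 0 = n ! * c n := by
    intro n
    induction n using Nat.strong_induction_on with | _ n ih
    rcases n with _ | m
    · have h0 := iteratedDeriv_eq_factorial_mul_coeff hA 0
      simp only [iteratedDeriv_zero, hb, mul_zero] at h0
      simp [h0, hc]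
    · rw [iteratedDeriv_succ', hderiv.iteratedDeriv_eq,
        iteratedDeriv_mul hsA.deriv.contDiffAt hsE.contDiffAt, Nat.factorial_succ]
      push_cast
      rw [mul_right_comm, hrec, Finset.sum_mul]
      refine Finset.sum_congr rfl fun k hk => ?_
      have hk' : k ≤ m := by simpa [Nat.lt_succ_iff] using hk
      rw [← iteratedDeriv_succ', iteratedDeriv_eq_factorial_mul_coeff hA, ih (m - k) (by omega),
        ← Nat.choose_mul_factorial_mul_factorial hk', Nat.factorial_succ]
      push_cast
      ring
  have h := Complex.hasSum_taylorSeries_on_ball hdE (z := z) (by simpa using hz)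
  refine Eq.mpr (congrArg (HasSum · _) (funext fun n => ?_)) h
  rw [hcoeff, smul_eq_mul, smul_eq_mul, sub_zero]
  have hn : (n ! : ℂ) ≠ 0 := Nat.cast_ne_zero.2 n.factorial_ne_zero
  field_simp

theorem summable_norm_of_polynomial_growth {a : ℕ → ℕ} {C d : ℝ}
    (ha : ∀ n : ℕ, 1 ≤ n → (a n : ℝ) ≤ C * (n : ℝ) ^ d) {z : ℂ} (hz : ‖z‖ < 1) :
    Summable fun δ : ℕ => ‖(a (δ + 1) : ℂ) * z ^ (δ + 1) / ((δ + 1 : ℕ) : ℂ)‖ := by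
  have hs := (summable_nat_add_iff 1).2
    ((summable_norm_pow_mul_geometric_of_norm_lt_one ⌈d⌉₊ hz).mul_left |C|)
  refine Summable.of_nonneg_of_le (fun _ => norm_nonneg _) (fun δ => ?_) hs
  have h1 : (1 : ℝ) ≤ ((δ + 1 : ℕ) : ℝ) := by exact_mod_cast Nat.le_add_left 1 δ
  have h2 : (a (δ + 1) : ℝ) ≤ |C| * ((δ + 1 : ℕ) : ℝ) ^ ⌈d⌉₊ := by
    refine (ha (δ + 1) (Nat.le_add_left 1 δ)).trans ?_
    rw [← Real.rpow_natCast]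
    exact mul_le_mul (le_abs_self C) (Real.rpow_le_rpow_of_exponent_le h1 (Nat.le_ceil d))
      (by positivity) (abs_nonneg C)
  rw [norm_div, norm_mul, norm_mul, norm_pow, norm_pow, Complex.norm_natCast, Complex.norm_natCast,
    ← mul_assoc]
  refine (div_le_self (by positivity) h1).trans ?_
  gcongr

end Analysis

/-- Bantay's exponential formula, analytic form. -/
theorem bantay_exponential_formula
    (G : Type*) [Group G] [Group.FG G]
    (C d : ℝ) (hC : 0 < C) (hd : 0 ≤ d)
    (hgrow : ∀ n : ℕ, 1 ≤ n → (aCount G n : ℝ) ≤ C * (n : ℝ) ^ d)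
    (x : ℝ) (hx : 0 < x) (z : ℂ) (hz : ‖z‖ < 1) :
    (Summable fun δ : ℕ => ‖(aCount G (δ + 1) : ℂ) * z ^ (δ + 1) / ((δ + 1 : ℕ) : ℂ)‖) ∧
    (Summable fun n : ℕ => ‖(Hpoly G n x : ℂ) * z ^ n‖) ∧
    ∑' n : ℕ, (Hpoly G n x : ℂ) * z ^ n =
      Complex.exp ((x : ℂ) *
        ∑' δ : ℕ, (aCount G (δ + 1) : ℂ) * z ^ (δ + 1) / ((δ + 1 : ℕ) : ℂ)) := by
  have hsum : ∀ w : ℂ, ‖w‖ < 1 →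
      Summable fun δ : ℕ => ‖(aCount G (δ + 1) : ℂ) * w ^ (δ + 1) / ((δ + 1 : ℕ) : ℂ)‖ :=
    fun w hw => summable_norm_of_polynomial_growth hgrow hw
  let A : ℂ → ℂ := fun w =>
    x * ∑' δ : ℕ, (aCount G (δ + 1) : ℂ) * w ^ (δ + 1) / ((δ + 1 : ℕ) : ℂ)
  have hA : ∀ w : ℂ, ‖w‖ < 1 →
      HasSum (fun n : ℕ => w ^ n * ((x : ℂ) * aCount G n / (n : ℂ))) (A w) := by
    intro w hw
    rw [← hasSum_nat_add_iff' 1]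
    have h := (hsum w hw).of_norm.hasSum.mul_left (x : ℂ)
    rw [Finset.sum_range_one, Nat.cast_zero, div_zero, mul_zero, sub_zero]
    exact Eq.mpr (congrArg (HasSum · _) (funext fun n => by ring)) h
  have hH : HasSum (fun n : ℕ => z ^ n * (Hpoly G n x : ℂ)) (Complex.exp (A z)) := by
    refine hasSum_exp_of_recurrence hA (by simp) (by rw [Hpoly_zero, Complex.ofReal_one])
      (fun m => ?_) hz
    have h := congrArg (fun t : ℝ => (t : ℂ)) (succ_mul_Hpoly_succ (G := G) m x)
    push_cast at h
    rw [h]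
    refine Finset.sum_congr rfl fun k _ => ?_
    have hk : ((k : ℂ) + 1) ≠ 0 := Nat.cast_add_one_ne_zero k
    push_cast
    field_simp
  simp only [mul_comm (z ^ _)] at hH
  exact ⟨hsum z hz, hH.summable.norm, hH.tsum_eq⟩
end

section
/- Let G be a finitely generated group, n ≥ 1 and 1 ≤ k ≤ n integers. Let A(G,n,k) be the number of group homomorphisms φ : G → Equiv.Perm (Fin n) whose induced action on Fin n has exactly k orbits. Then, as an identity of rational numbers, A(G,n,k) = (n!/k!) · ∑ over all k-tuples (n₁, …, n_k) of positive integers with n₁ + ⋯ + n_k = n of the product ∏_{i=1}^{k} a_{n_i}(G)/n_i. -/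
open scoped BigOperators

open MulAction in
theorem mk_orbitRel_eq_iff {G : Type*} [Group G] {n : ℕ} (φ : G →* Equiv.Perm (Fin n))
    (a b : Fin n) :
    Quotient.mk (orbitRel φ.range (Fin n)) a = Quotient.mk (orbitRel φ.range (Fin n)) b ↔
      ∃ g, φ g b = a := by
  rw [Quotient.eq, orbitRel_apply, mem_orbit_iff]
  constructor
  · rintro ⟨⟨_, g, rfl⟩, h⟩
    exact ⟨g, h⟩
  · rintro ⟨g, h⟩
    exact ⟨⟨φ g, g, rfl⟩, h⟩

/-- The stabilizer of `x` under the action of `G` induced by `φ`. -/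
def pointStabilizer {G : Type*} [Group G] {n : ℕ} (φ : G →* Equiv.Perm (Fin n)) (x : Fin n) :
    Subgroup G :=
  (MulAction.stabilizer φ.range x).comap φ.rangeRestrict

theorem mem_pointStabilizer {G : Type*} [Group G] {n : ℕ} (φ : G →* Equiv.Perm (Fin n))
    (x : Fin n) (g : G) : g ∈ pointStabilizer φ x ↔ φ g x = x := Iff.rfl

theorem index_pointStabilizer {G : Type*} [Group G] {n : ℕ} (φ : G →* Equiv.Perm (Fin n))
    (x : Fin n) :
    (pointStabilizer φ x).index = Nat.card {y : Fin n //
      Quotient.mk (MulAction.orbitRel φ.range (Fin n)) y = Quotient.mk _ x} := by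
  rw [pointStabilizer, Subgroup.index_comap_of_surjective _ φ.rangeRestrict_surjective,
    MulAction.index_stabilizer, ← Nat.card_coe_set_eq]
  exact Nat.card_congr (Equiv.subtypeEquivRight fun y => by
    rw [Quotient.eq, MulAction.orbitRel_apply])

theorem index_pointStabilizer_pos {G : Type*} [Group G] {n : ℕ} (φ : G →* Equiv.Perm (Fin n))
    (x : Fin n) : 0 < (pointStabilizer φ x).index := by
  rw [index_pointStabilizer]
  have : Nonempty {y : Fin n //
      Quotient.mk (MulAction.orbitRel φ.range (Fin n)) y = Quotient.mk _ x} := ⟨⟨x, rfl⟩⟩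
  exact Nat.card_pos

/-- The family `x` meets every orbit of the action induced by `φ` exactly once. -/
def IsOrbitTransversal {G : Type*} [Group G] {n k : ℕ} (φ : G →* Equiv.Perm (Fin n))
    (x : Fin k → Fin n) : Prop :=
  Function.Bijective fun i => Quotient.mk (MulAction.orbitRel φ.range (Fin n)) (x i)

theorem sum_index_pointStabilizer {G : Type*} [Group G] {n k : ℕ} (φ : G →* Equiv.Perm (Fin n))
    (x : Fin k → Fin n) (hx : IsOrbitTransversal φ x) :
    ∑ i, (pointStabilizer φ (x i)).index = n := by
  classical
  simp only [index_pointStabilizer]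
  rw [← Nat.card_sigma]
  let e := Equiv.ofBijective _ hx
  refine (Nat.card_congr ((Equiv.sigmaCongrLeft (β := fun q => {y : Fin n //
    Quotient.mk (MulAction.orbitRel φ.range (Fin n)) y = q}) e).trans
      (Equiv.sigmaFiberEquiv _))).trans (by simp)

instance finite_monoidHom_of_fg {G M : Type*} [Group G] [Group.FG G] [Monoid M] [Finite M] :
    Finite (G →* M) := by
  obtain ⟨S, hS⟩ := Group.fg_def.1 ‹Group.FG G›
  refine Finite.of_injective (fun (φ : G →* M) (s : S) => φ s) fun φ ψ h => ?_
  exact MonoidHom.eq_of_eqOn_dense hS fun s hs => congrFun h ⟨s, hs⟩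

/-- Summing the reciprocals of the fibre sizes over all lifts of bijections `ι → Q` along
a map `q : α → Q` counts the bijections. -/
theorem sum_bijective_comp_inv_card_fiber {α Q ι : Type*} [Fintype α] [Fintype Q] [Fintype ι]
    [DecidableEq ι] [DecidableEq Q] {q : α → Q} (hq : Function.Surjective q)
    [DecidablePred fun x : ι → α => Function.Bijective fun i => q (x i)] :
    ∑ x : ι → α with Function.Bijective fun i => q (x i),
      ∏ i, (1 / (Nat.card {y // q y = q (x i)} : ℚ)) = Nat.card (ι ≃ Q) := by
  classical
  rw [← Finset.sum_fiberwise_of_maps_to (t := Finset.univ.filter Function.Bijective)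
    (g := fun (x : ι → α) i => q (x i)) (by simp)]
  have key : ∀ f ∈ Finset.univ.filter (Function.Bijective : (ι → Q) → Prop),
      ∑ x ∈ (Finset.univ.filter fun x : ι → α => Function.Bijective fun i => q (x i)) with
        (fun i => q (x i)) = f, ∏ i, (1 / (Nat.card {y // q y = q (x i)} : ℚ)) = 1 := by
    intro f hf
    have hset : ((Finset.univ.filter fun x : ι → α => Function.Bijective fun i => q (x i)).filter
        fun x => (fun i => q (x i)) = f) =
        Fintype.piFinset fun i => Finset.univ.filter fun y => q y = f i := by
      ext x
      simp only [Finset.mem_filter, Finset.mem_univ, true_and, Fintype.mem_piFinset] at hf ⊢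
      constructor
      · rintro ⟨-, rfl⟩ i
        rfl
      · intro h
        have : (fun i => q (x i)) = f := funext h
        exact ⟨this ▸ hf, this⟩
    rw [hset]
    have : ∀ x ∈ Fintype.piFinset fun i => Finset.univ.filter fun y => q y = f i,
        ∏ i, (1 / (Nat.card {y // q y = q (x i)} : ℚ)) =
          ∏ i, (1 / (Nat.card {y // q y = f i} : ℚ)) := by
      intro x hx
      refine Finset.prod_congr rfl fun i _ => ?_
      have hxi : q (x i) = f i := by simpa using Fintype.mem_piFinset.1 hx i
      rw [hxi]
    rw [Finset.sum_congr rfl this, ← Finset.prod_univ_sum (fun i =>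
      Finset.univ.filter fun y => q y = f i) fun i _ => (1 / (Nat.card {y // q y = f i} : ℚ))]
    refine Finset.prod_eq_one fun i _ => ?_
    obtain ⟨y, hy⟩ := hq (f i)
    have hne : Nonempty {y // q y = f i} := ⟨⟨y, hy⟩⟩
    have h0 : (Nat.card {y // q y = f i} : ℚ) ≠ 0 := by exact_mod_cast Nat.card_pos.ne'
    rw [Finset.sum_const, nsmul_eq_mul, ← Fintype.card_subtype, ← Nat.card_eq_fintype_card]
    field_simp
  rw [Finset.sum_congr rfl key, Finset.sum_const, nsmul_eq_mul, mul_one,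
    ← Fintype.card_subtype, ← Nat.card_eq_fintype_card]
  exact congrArg _ (Nat.card_congr (Equiv.ofBijective
    (fun f : {f : ι → Q // Function.Bijective f} => Equiv.ofBijective f.1 f.2)
    ⟨fun f g h => Subtype.ext (congrArg (fun e : ι ≃ Q => (e : ι → Q)) h),
      fun e => ⟨⟨e, e.bijective⟩, Equiv.ext fun _ => rfl⟩⟩))

theorem natCard_equiv_fin {Q : Type*} [Finite Q] (k : ℕ) [Decidable (Nat.card Q = k)] :
    Nat.card (Fin k ≃ Q) = if Nat.card Q = k then k.factorial else 0 := by
  classical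
  have := Fintype.ofFinite Q
  split_ifs with h
  · have e : Fin k ≃ Q := (Finite.equivFinOfCardEq h).symm
    rw [Nat.card_eq_fintype_card, Fintype.card_equiv e, Fintype.card_fin]
  · have : IsEmpty (Fin k ≃ Q) := ⟨fun e => h (by simpa using (Nat.card_congr e).symm)⟩
    exact Nat.card_of_isEmpty

open Classical in
theorem sum_transversal_inv_index {G : Type*} [Group G] {n : ℕ} (k : ℕ)
    (φ : G →* Equiv.Perm (Fin n)) :
    ∑ x : Fin k → Fin n with IsOrbitTransversal φ x,
      ∏ i, (1 / ((pointStabilizer φ (x i)).index : ℚ)) =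
        if numOrbits φ = k then (k.factorial : ℚ) else 0 := by
  have h := sum_bijective_comp_inv_card_fiber (ι := Fin k)
    (Quotient.mk_surjective (s := MulAction.orbitRel φ.range (Fin n)))
  rw [natCard_equiv_fin] at h
  simp only [index_pointStabilizer]
  refine Eq.trans (Finset.sum_congr ?_ fun _ _ => rfl) (h.trans (Nat.cast_ite _ _ _))
  ext x
  exact ⟨fun hx => Finset.mem_filter.2 ⟨Finset.mem_univ x, (Finset.mem_filter.1 hx).2⟩,
    fun hx => Finset.mem_filter.2 ⟨Finset.mem_univ x, (Finset.mem_filter.1 hx).2⟩⟩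

section CosetAction

variable {G : Type*} [Group G] {n k : ℕ} (H : Fin k → Subgroup G)

/-- The action of `G` on the disjoint union of the coset spaces `G ⧸ H i`, transported to
`Fin n` along a bijection. -/
def cosetAction (b : (Σ i, G ⧸ H i) ≃ Fin n) : G →* Equiv.Perm (Fin n) :=
  b.permCongrHom.toMonoidHom.comp (MulAction.toPermHom G (Σ i, G ⧸ H i))

/-- The points of `Fin n` corresponding to the trivial cosets. -/
def cosetBasePoint (b : (Σ i, G ⧸ H i) ≃ Fin n) (i : Fin k) : Fin n :=
  b ⟨i, ((1 : G) : G ⧸ H i)⟩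

variable {H}

theorem cosetAction_apply (b : (Σ i, G ⧸ H i) ≃ Fin n) (g : G) (z : Σ i, G ⧸ H i) :
    cosetAction H b g (b z) = b (g • z) := by
  simp [cosetAction, Equiv.permCongrHom, Equiv.permCongr_apply]

theorem cosetAction_basePoint (b : (Σ i, G ⧸ H i) ≃ Fin n) (g : G) (i : Fin k) :
    cosetAction H b g (cosetBasePoint H b i) = b ⟨i, (g : G ⧸ H i)⟩ := by
  rw [cosetBasePoint, cosetAction_apply, Sigma.smul_mk, MulAction.Quotient.smul_coe,
    smul_eq_mul, mul_one]

theorem pointStabilizer_cosetAction (b : (Σ i, G ⧸ H i) ≃ Fin n) (i : Fin k) :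
    pointStabilizer (cosetAction H b) (cosetBasePoint H b i) = H i := by
  ext g
  rw [mem_pointStabilizer, cosetAction_basePoint, cosetBasePoint, b.apply_eq_iff_eq,
    Sigma.mk.inj_iff, heq_eq_eq, eq_comm (a := (g : G ⧸ H i)), QuotientGroup.eq]
  simp

theorem isOrbitTransversal_cosetAction (b : (Σ i, G ⧸ H i) ≃ Fin n) :
    IsOrbitTransversal (cosetAction H b) (cosetBasePoint H b) := by
  constructor
  · intro i j hij
    obtain ⟨g, hg⟩ := (mk_orbitRel_eq_iff _ _ _).1 hij
    rw [cosetAction_basePoint, cosetBasePoint, b.apply_eq_iff_eq] at hg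
    exact (Sigma.mk.inj_iff.1 hg).1.symm
  · intro y
    obtain ⟨y, rfl⟩ := Quotient.mk_surjective y
    obtain ⟨⟨i, c⟩, rfl⟩ := b.surjective y
    obtain ⟨g, rfl⟩ := QuotientGroup.mk_surjective c
    refine ⟨i, Eq.symm ((mk_orbitRel_eq_iff _ _ _).2 ⟨g, cosetAction_basePoint b g i⟩)⟩

theorem exists_cosetAction_eq (φ : G →* Equiv.Perm (Fin n)) (x : Fin k → Fin n)
    (hx : IsOrbitTransversal φ x) (hH : ∀ i, pointStabilizer φ (x i) = H i) :
    ∃ b : (Σ i, G ⧸ H i) ≃ Fin n, cosetAction H b = φ ∧ cosetBasePoint H b = x := by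
  have hcos : ∀ i (g g' : G), (g : G ⧸ H i) = g' ↔ φ g (x i) = φ g' (x i) := by
    intro i g g'
    rw [QuotientGroup.eq, ← hH i, mem_pointStabilizer, map_mul, map_inv, Equiv.Perm.mul_apply,
      Equiv.Perm.inv_eq_iff_eq, eq_comm]
  let f : (Σ i, G ⧸ H i) → Fin n := fun z =>
    Quotient.lift (fun g : G => φ g (x z.1))
      (fun g g' h => (hcos z.1 g g').1 (Quotient.sound h)) z.2
  have hf : ∀ i (g : G), f ⟨i, (g : G ⧸ H i)⟩ = φ g (x i) := fun _ _ => rfl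
  have hbij : Function.Bijective f := by
    constructor
    · rintro ⟨i, c⟩ ⟨j, d⟩ h
      obtain ⟨g, rfl⟩ := QuotientGroup.mk_surjective c
      obtain ⟨g', rfl⟩ := QuotientGroup.mk_surjective d
      rw [hf, hf] at h
      have hij : i = j := hx.1 ((mk_orbitRel_eq_iff _ _ _).2 ⟨g⁻¹ * g', by
        rw [map_mul, Equiv.Perm.mul_apply, ← h, map_inv, Equiv.Perm.inv_eq_iff_eq]⟩)
      subst hij
      rw [(hcos i g g').2 h]
    · intro y
      obtain ⟨i, hi⟩ := hx.2 (Quotient.mk _ y)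
      obtain ⟨g, hg⟩ := (mk_orbitRel_eq_iff _ _ _).1 hi.symm
      exact ⟨⟨i, (g : G ⧸ H i)⟩, hg⟩
  refine ⟨Equiv.ofBijective f hbij, ?_, ?_⟩
  · ext g y : 2
    obtain ⟨⟨i, c⟩, rfl⟩ := (Equiv.ofBijective f hbij).surjective y
    obtain ⟨g', rfl⟩ := QuotientGroup.mk_surjective c
    rw [cosetAction_apply, Sigma.smul_mk, MulAction.Quotient.smul_coe, Equiv.ofBijective_apply,
      Equiv.ofBijective_apply, hf, hf, smul_eq_mul, map_mul, Equiv.Perm.mul_apply]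
  · funext i
    rw [cosetBasePoint, Equiv.ofBijective_apply, hf, map_one, Equiv.Perm.one_apply]

variable (H) in
theorem natCard_transversal_with_stabilizers (hpos : ∀ i, 0 < (H i).index)
    (hsum : ∑ i, (H i).index = n) :
    Nat.card {p : (G →* Equiv.Perm (Fin n)) × (Fin k → Fin n) //
      IsOrbitTransversal p.1 p.2 ∧ (fun i => pointStabilizer p.1 (p.2 i)) = H} =
        n.factorial := by
  classical
  have hfin : ∀ i, Finite (G ⧸ H i) := fun i => Nat.finite_of_card_ne_zero (hpos i).ne'
  have hcard : Nat.card (Σ i, G ⧸ H i) = Nat.card (Fin n) := by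
    rw [Nat.card_sigma, Nat.card_fin]
    exact hsum
  have hequiv : Nat.card ((Σ i, G ⧸ H i) ≃ Fin n) = n.factorial := by
    have := Fintype.ofFinite (Σ i, G ⧸ H i)
    rw [Nat.card_eq_fintype_card, Fintype.card_equiv (Finite.card_eq.1 hcard).some,
      ← Nat.card_eq_fintype_card, hcard, Nat.card_fin]
  rw [← hequiv]
  refine (Nat.card_eq_of_bijective (fun b => ⟨(cosetAction H b, cosetBasePoint H b),
    isOrbitTransversal_cosetAction b, funext (pointStabilizer_cosetAction b)⟩) ⟨?_, ?_⟩).symm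
  · intro b b' h
    obtain ⟨h1, h2⟩ := Prod.mk.inj (Subtype.mk.inj h)
    ext ⟨i, c⟩ : 1
    obtain ⟨g, rfl⟩ := QuotientGroup.mk_surjective c
    rw [← cosetAction_basePoint, ← cosetAction_basePoint, h1, h2]
  · rintro ⟨⟨φ, x⟩, hx, hH⟩
    obtain ⟨b, hb1, hb2⟩ := exists_cosetAction_eq φ x hx (congrFun hH)
    exact ⟨b, Subtype.ext (Prod.ext hb1 hb2)⟩

end CosetAction

theorem natCard_subgroups_of_index {G : Type*} [Group G] {k : ℕ} (ν : Fin k → ℕ) :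
    Nat.card {H : Fin k → Subgroup G // ∀ i, (H i).index = ν i} = ∏ i, aCount G (ν i) := by
  rw [Nat.card_congr (Equiv.subtypePiEquivPi (p := fun i (K : Subgroup G) => K.index = ν i)),
    Nat.card_pi]
  rfl

theorem orbit_count_formula
    (G : Type*) [Group G] [Group.FG G] (n k : ℕ)
    (hn : 1 ≤ n) (hk : 1 ≤ k) (hkn : k ≤ n) :
    (Nat.card {φ : G →* Equiv.Perm (Fin n) // numOrbits φ = k} : ℚ) =
      (Nat.factorial n : ℚ) / (Nat.factorial k : ℚ) *
        ∑ᶠ (ν : Fin k → ℕ) (_ : (∀ i, 0 < ν i) ∧ ∑ i, ν i = n),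
          ∏ i : Fin k, (aCount G (ν i) : ℚ) / (ν i : ℚ) := by
  classical
  have := Fintype.ofFinite (G →* Equiv.Perm (Fin n))
  let P : Finset ((G →* Equiv.Perm (Fin n)) × (Fin k → Fin n)) :=
    Finset.univ.filter fun p => IsOrbitTransversal p.1 p.2
  let st : (G →* Equiv.Perm (Fin n)) × (Fin k → Fin n) → Fin k → Subgroup G :=
    fun p i => pointStabilizer p.1 (p.2 i)
  let T : Finset (Fin k → Subgroup G) := P.image st
  let N : Finset (Fin k → ℕ) :=
    (Finset.univ.piAntidiag n).filter fun ν => ∀ i, 0 < ν i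
  have hN : ∀ ν, ν ∈ N ↔ (∀ i, 0 < ν i) ∧ ∑ i, ν i = n := by
    intro ν
    simp [N, and_comm]
  have hfib : ∀ H : Fin k → Subgroup G, (fun i => (H i).index) ∈ N →
      (P.filter fun p => st p = H).card = n.factorial := by
    intro H hH
    rw [hN] at hH
    rw [← natCard_transversal_with_stabilizers H hH.1 hH.2, Finset.filter_filter,
      ← Fintype.card_subtype, ← Nat.card_eq_fintype_card]
  have hT : ∀ H : Fin k → Subgroup G, H ∈ T ↔ (fun i => (H i).index) ∈ N := by
    intro H
    constructor
    · intro h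
      obtain ⟨p, hp, rfl⟩ := Finset.mem_image.1 h
      exact (hN _).2 ⟨fun i => index_pointStabilizer_pos _ _,
        sum_index_pointStabilizer _ _ (Finset.mem_filter.1 hp).2⟩
    · intro h
      obtain ⟨p, hp⟩ := Finset.card_pos.1 ((hfib H h).symm ▸ n.factorial_pos)
      obtain ⟨hp, hpH⟩ := Finset.mem_filter.1 hp
      exact Finset.mem_image.2 ⟨p, hp, hpH⟩
  have hleft : ∑ p ∈ P, ∏ i, (1 / ((st p i).index : ℚ)) =
      Nat.card {φ : G →* Equiv.Perm (Fin n) // numOrbits φ = k} * k.factorial := by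
    simp only [P, st, Finset.sum_filter]
    rw [Fintype.sum_prod_type]
    simp only [← Finset.sum_filter, sum_transversal_inv_index]
    rw [Finset.sum_const, nsmul_eq_mul, ← Fintype.card_subtype,
      ← Nat.card_eq_fintype_card]
  have hright : ∑ p ∈ P, ∏ i, (1 / ((st p i).index : ℚ)) =
      ∑ H ∈ T, (n.factorial : ℚ) * ∏ i, (1 / ((H i).index : ℚ)) := by
    rw [← Finset.sum_fiberwise_of_maps_to (t := T) (g := st)
      fun p hp => Finset.mem_image_of_mem _ hp]
    refine Finset.sum_congr rfl fun H hH => ?_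
    rw [← hfib H ((hT H).1 hH), ← nsmul_eq_mul, ← Finset.sum_const]
    refine Finset.sum_congr rfl fun p hp => ?_
    rw [(Finset.mem_filter.1 hp).2]
  have hindex : ∑ H ∈ T, ∏ i, (1 / ((H i).index : ℚ)) =
      ∑ ν ∈ N, ∏ i, (aCount G (ν i) : ℚ) / (ν i : ℚ) := by
    rw [← Finset.sum_fiberwise_of_maps_to (t := N)
      (g := fun (H : Fin k → Subgroup G) i => (H i).index) fun H hH => (hT H).1 hH]
    refine Finset.sum_congr rfl fun ν hν => ?_
    have hcard : (T.filter fun H => (fun i => (H i).index) = ν).card = ∏ i, aCount G (ν i) := by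
      rw [← natCard_subgroups_of_index, ← Fintype.card_coe, ← Nat.card_eq_fintype_card]
      refine Nat.card_congr (Equiv.subtypeEquivRight fun H => ?_)
      rw [Finset.mem_filter, hT, ← funext_iff]
      exact ⟨fun h => h.2, fun h => ⟨h ▸ hν, h⟩⟩
    rw [Finset.sum_congr rfl (g := fun _ => ∏ i, (1 / (ν i : ℚ))), Finset.sum_const, hcard,
      nsmul_eq_mul, Nat.cast_prod, ← Finset.prod_mul_distrib]
    · simp only [mul_one_div]
    · intro H hH
      rw [← (Finset.mem_filter.1 hH).2]
  rw [finsum_cond_eq_sum_of_cond_iff (t := N) _ fun _ => (hN _).symm, ← hindex]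
  have hk0 : (k.factorial : ℚ) ≠ 0 := by exact_mod_cast k.factorial_ne_zero
  rw [div_mul_eq_mul_div, eq_div_iff hk0, ← hleft, hright, Finset.mul_sum]
end

section
/- (Minor arc estimate.) For all real u, θ with 0 < u ≤ |θ| ≤ π, the real part of ∑_{k=1}^{∞} e^{−ku}(1 − e^{ikθ}) is at least e^u·(e^u + 1)·(1 − cos u) / ((e^u − 1)·(e^{2u} − 2·e^u·cos u + 1)). Moreover, this lower bound is asymptotically equivalent to 1/(2u) as u → 0⁺, i.e. the ratio of the bound to 1/(2u) tends to 1. -/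
open Real

/-- The minor arc lower bound `e^u (e^u + 1)(1 - cos u) / ((e^u - 1)(e^{2u} - 2 e^u cos u + 1))`. -/
noncomputable def minorBound (u : ℝ) : ℝ :=
  Real.exp u * (Real.exp u + 1) * (1 - Real.cos u) /
    ((Real.exp u - 1) * (Real.exp (2 * u) - 2 * Real.exp u * Real.cos u + 1))

lemma sq_sub_two_mul_mul_add_one_pos {E x : ℝ} (hE : 1 < E) (hx : x ≤ 1) :
    0 < E ^ 2 - 2 * E * x + 1 := by
  have h : 0 ≤ E * (1 - x) := mul_nonneg (by linarith) (sub_nonneg.2 hx)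
  nlinarith [sq_pos_of_pos (sub_pos.2 hE)]

open Filter Topology in
lemma tendsto_exp_sub_one_div :
    Tendsto (fun u : ℝ => (Real.exp u - 1) / u) (𝓝[>] 0) (𝓝 1) := by
  have h := (hasDerivAt_iff_tendsto_slope.1 (Real.hasDerivAt_exp 0)).mono_left
    (nhdsGT_le_nhdsNE (0 : ℝ))
  simpa [slope_fun_def_field] using h

open Filter Topology in
lemma tendsto_one_sub_cos_div_sq :
    Tendsto (fun u : ℝ => (1 - Real.cos u) / u ^ 2) (𝓝[>] 0) (𝓝 (1 / 2)) := by
  have hd : HasDerivAt (fun u : ℝ => Real.sin (u / 2)) (1 / 2) 0 := by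
    simpa using ((hasDerivAt_id (0 : ℝ)).div_const 2).sin
  have h := (hasDerivAt_iff_tendsto_slope.1 hd).mono_left (nhdsGT_le_nhdsNE (0 : ℝ))
  have h2 := (h.pow 2).const_mul 2
  have e : (2 : ℝ) * (1 / 2) ^ 2 = 1 / 2 := by norm_num
  rw [e] at h2
  refine h2.congr fun u => ?_
  have hc : Real.cos u = 1 - 2 * Real.sin (u / 2) ^ 2 := by
    rw [← Real.cos_two_mul_eq_one_sub]; ring_nf
  simp only [slope_def_field, hc, zero_div, Real.sin_zero, sub_zero, div_pow]
  ring

lemma re_tsum_exp_mul_one_sub_exp {u : ℝ} (hu : 0 < u) (θ : ℝ) :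
    (∑' k : ℕ, (Real.exp (-((k : ℝ) + 1) * u) : ℂ) *
        (1 - Complex.exp (Complex.I * ((k + 1 : ℕ) : ℂ) * (θ : ℂ)))).re =
      Real.exp u * (Real.exp u + 1) * (1 - Real.cos θ) /
        ((Real.exp u - 1) * (Real.exp (2 * u) - 2 * Real.exp u * Real.cos θ + 1)) := by
  set E := Real.exp u with hE
  have hE1 : 1 < E := Real.one_lt_exp_iff.2 hu
  set c := Real.cos θ with hc
  have hc1 : c ≤ 1 := Real.cos_le_one θ
  have hE2 : Real.exp (2 * u) = E ^ 2 := by rw [hE, ← Real.exp_nat_mul]; norm_num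
  have hD : 0 < E ^ 2 - 2 * E * c + 1 :=
    sq_sub_two_mul_mul_add_one_pos hE1 hc1
  set r : ℂ := ((E⁻¹ : ℝ) : ℂ) with hr
  set z : ℂ := Complex.exp (θ * Complex.I) with hz
  have hz1 : ‖z‖ = 1 := Complex.norm_exp_ofReal_mul_I θ
  have hr1 : ‖r‖ < 1 := by
    rw [hr, Complex.norm_real, Real.norm_of_nonneg (by positivity)]
    exact inv_lt_one_of_one_lt₀ hE1
  have hrz1 : ‖r * z‖ < 1 := by rwa [norm_mul, hz1, mul_one]
  have hterm (k : ℕ) : (Real.exp (-((k : ℝ) + 1) * u) : ℂ) *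
      (1 - Complex.exp (Complex.I * ((k + 1 : ℕ) : ℂ) * (θ : ℂ))) =
      r * r ^ k - (r * z) * (r * z) ^ k := by
    have h1 : (Real.exp (-((k : ℝ) + 1) * u) : ℂ) = r ^ (k + 1) := by
      rw [hr, hE, ← Real.exp_neg, ← Complex.ofReal_pow, ← Real.exp_nat_mul]
      push_cast; ring_nf
    have h2 : Complex.exp (Complex.I * ((k + 1 : ℕ) : ℂ) * (θ : ℂ)) = z ^ (k + 1) := by
      rw [hz, ← Complex.exp_nat_mul]; ring_nf
    rw [h1, h2]; ring
  have hsum := ((hasSum_geometric_of_norm_lt_one hr1).mul_left r).sub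
    ((hasSum_geometric_of_norm_lt_one hrz1).mul_left (r * z))
  rw [tsum_congr hterm, hsum.tsum_eq, hE2]
  have hre : z.re = c := Complex.exp_ofReal_mul_I_re θ
  have him : z.im ^ 2 = 1 - c ^ 2 := by
    rw [hz, Complex.exp_ofReal_mul_I_im, Real.sin_sq]
  have hEz : (E : ℂ) - z ≠ 0 := by
    intro h
    rw [← sub_eq_zero.1 h, Complex.norm_real, Real.norm_of_nonneg (by positivity)] at hz1
    linarith
  have hE0 : (E : ℂ) ≠ 0 := by exact_mod_cast (by positivity : E ≠ 0)
  have hEm : (E : ℂ) - 1 ≠ 0 := by exact_mod_cast (by linarith : 0 < E - 1).ne'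
  have e1 : r * (1 - r)⁻¹ = ((E - 1)⁻¹ : ℝ) := by
    rw [hr]; push_cast
    field_simp
  have e2 : r * z * (1 - r * z)⁻¹ = z / (E - z) := by
    have : 1 - r * z = (E - z) / E := by rw [hr]; push_cast; field_simp
    rw [this, hr]; push_cast; field_simp
  have hn : Complex.normSq ((E : ℂ) - z) = E ^ 2 - 2 * E * c + 1 := by
    rw [Complex.normSq_apply]
    simp only [Complex.sub_re, Complex.sub_im, Complex.ofReal_re, Complex.ofReal_im, hre]
    linear_combination him
  rw [e1, e2, Complex.sub_re, Complex.ofReal_re, Complex.div_re, hn]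
  simp only [Complex.sub_re, Complex.sub_im, Complex.ofReal_re, Complex.ofReal_im, hre]
  have hE3 : E - 1 ≠ 0 := by linarith
  have hD' := hD.ne'
  have : z.im * (0 - z.im) = c ^ 2 - 1 := by linear_combination -him
  rw [this]
  generalize hd : E ^ 2 - 2 * E * c + 1 = D at hD' ⊢
  field_simp
  rw [← hd]
  ring

lemma minorBound_le_of_cos_le {u c : ℝ} (hu : 0 < u) (hc : c ≤ Real.cos u) :
    minorBound u ≤ Real.exp u * (Real.exp u + 1) * (1 - c) /
      ((Real.exp u - 1) * (Real.exp (2 * u) - 2 * Real.exp u * c + 1)) := by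
  have hE1 : 1 < Real.exp u := Real.one_lt_exp_iff.2 hu
  have hE2 : Real.exp (2 * u) = Real.exp u ^ 2 := by rw [← Real.exp_nat_mul]; norm_num
  have hc1 := Real.cos_le_one u
  rw [minorBound, hE2]
  generalize Real.exp u = E at *
  generalize Real.cos u = d at *
  have hE3 : 0 < E - 1 := by linarith
  rw [mul_div_mul_comm, mul_div_mul_comm]
  refine mul_le_mul_of_nonneg_left ?_ (by positivity)
  rw [div_le_div_iff₀ (sq_sub_two_mul_mul_add_one_pos hE1 hc1)
    (sq_sub_two_mul_mul_add_one_pos hE1 (hc.trans hc1))]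
  nlinarith [mul_nonneg (sub_nonneg.2 hc) (sq_nonneg (E - 1))]

open Filter Topology in
lemma minorBound_isEquivalent :
    Asymptotics.IsEquivalent (𝓝[>] 0) minorBound (fun u : ℝ => 1 / (2 * u)) := by
  have hpos : ∀ᶠ u : ℝ in 𝓝[>] 0, 0 < u := self_mem_nhdsWithin
  refine (Asymptotics.isEquivalent_iff_tendsto_one
    (hpos.mono fun u hu => by positivity)).2 ?_
  have hexp : Tendsto Real.exp (𝓝[>] 0) (𝓝 1) := by
    simpa using (Real.continuous_exp.tendsto 0).mono_left nhdsWithin_le_nhds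
  have hA := tendsto_exp_sub_one_div
  have hB := tendsto_one_sub_cos_div_sq
  have h := (((hexp.mul (hexp.add_const 1)).mul hB).const_mul 2).div
    (hA.mul ((hA.pow 2).add ((hexp.const_mul 2).mul hB))) (by norm_num)
  have e : (2 : ℝ) * (1 * (1 + 1) * (1 / 2)) / (1 * (1 ^ 2 + 2 * 1 * (1 / 2))) = 1 := by
    norm_num
  rw [e] at h
  refine h.congr' (hpos.mono fun u hu => ?_)
  have hE1 : 1 < Real.exp u := Real.one_lt_exp_iff.2 hu
  have hE2 : Real.exp (2 * u) = Real.exp u ^ 2 := by rw [← Real.exp_nat_mul]; norm_num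
  have hc1 := Real.cos_le_one u
  simp only [Pi.div_apply, minorBound, hE2]
  generalize Real.exp u = E at *
  generalize Real.cos u = d at *
  have hE3 : E - 1 ≠ 0 := by linarith
  have hsq : E ^ 2 - 2 * E * d + 1 = (E - 1) ^ 2 + 2 * E * (1 - d) := by ring
  have hD := sq_sub_two_mul_mul_add_one_pos hE1 hc1
  rw [hsq] at hD
  have hD' := hD.ne'
  have hs : ((E - 1) / u) ^ 2 + 2 * E * ((1 - d) / u ^ 2) =
      ((E - 1) ^ 2 + 2 * E * (1 - d)) / u ^ 2 := by ring
  rw [hsq, hs]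
  generalize (E - 1) ^ 2 + 2 * E * (1 - d) = D at *
  field_simp

theorem minor_arc_estimate :
    (∀ u θ : ℝ, 0 < u → u ≤ |θ| → |θ| ≤ Real.pi →
      minorBound u ≤
        (∑' k : ℕ,
          (Real.exp (-((k : ℝ) + 1) * u) : ℂ) *
            (1 - Complex.exp (Complex.I * ((k + 1 : ℕ) : ℂ) * (θ : ℂ)))).re) ∧
    Asymptotics.IsEquivalent (nhdsWithin 0 (Set.Ioi 0)) minorBound
      (fun u : ℝ => 1 / (2 * u)) := by
  refine ⟨fun u θ hu h1 h2 => ?_, minorBound_isEquivalent⟩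
  rw [re_tsum_exp_mul_one_sub_exp hu]
  apply minorBound_le_of_cos_le hu
  rw [← Real.cos_abs θ]
  exact Real.cos_le_cos_of_nonneg_of_le_pi hu.le h2 h1
end
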